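/- arXiv:2409.01796 — 2 statements merged into one kernel-verified Lean document; each statement's English description precedes it below -/
import Mathlib

section
/- If T is a finite tree (a connected acyclic simple graph), then b^A_g(T) ≥ 0 and b^I_g(T) ≥ 0. -/
open SimpleGraph

/-- The balance score of a state `(S0, S1)` in a graph `G`: the number of edges of `G` with
one endpoint in `S0` and the other in `S1`, minus the number of edges with both endpoints
in `S0` or both endpoints in `S1`. -/
noncomputable def bscore {V : Type*} (G : SimpleGraph V) (S0 S1 : Set V) : ℤ :=
  ({e ∈ G.edgeSet | ∃ u ∈ S0, ∃ v ∈ S1, e = s(u, v)}.ncard : ℤ) -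
  ({e ∈ G.edgeSet | (∃ u ∈ S0, ∃ v ∈ S0, e = s(u, v)) ∨
      (∃ u ∈ S1, ∃ v ∈ S1, e = s(u, v))}.ncard : ℤ)

/-- The value of the balance game computed by backward induction, with `k` moves remaining.
`t = true` means it is Admirable's (the minimizer's) turn, `t = false` means it is
Impish's (the maximizer's) turn.  `S0` is the set of vertices selected by Admirable so far,
`S1` the set selected by Impish. -/
noncomputable def gameVal {V : Type*} [Fintype V] (G : SimpleGraph V) :
    ℕ → Bool → Finset V → Finset V → ℤ
  | 0, _, S0, S1 => bscore G ↑S0 ↑S1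
  | (k + 1), t, S0, S1 =>
    letI := Classical.decEq V
    if h : (Finset.univ \ (S0 ∪ S1)).Nonempty then
      if t then (Finset.univ \ (S0 ∪ S1)).inf' h fun v => gameVal G k false (insert v S0) S1
      else (Finset.univ \ (S0 ∪ S1)).sup' h fun v => gameVal G k true S0 (insert v S1)
    else bscore G ↑S0 ↑S1

/-- The (A)-start game balance number `b^A_g(G)`. -/
noncomputable def balA {V : Type*} [Fintype V] (G : SimpleGraph V) : ℤ :=
  gameVal G (Fintype.card V) true ∅ ∅

/-- The (I)-start game balance number `b^I_g(G)`. -/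
noncomputable def balI {V : Type*} [Fintype V] (G : SimpleGraph V) : ℤ :=
  gameVal G (Fintype.card V) false ∅ ∅

/-- The value of the cordiality game computed by backward induction (final score is
`|bscore|`), with `k` moves remaining; `t = true` means it is Admirable's turn. -/
noncomputable def cordVal {V : Type*} [Fintype V] (G : SimpleGraph V) :
    ℕ → Bool → Finset V → Finset V → ℤ
  | 0, _, S0, S1 => |bscore G ↑S0 ↑S1|
  | (k + 1), t, S0, S1 =>
    letI := Classical.decEq V
    if h : (Finset.univ \ (S0 ∪ S1)).Nonempty then
      if t then (Finset.univ \ (S0 ∪ S1)).inf' h fun v => cordVal G k false (insert v S0) S1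
      else (Finset.univ \ (S0 ∪ S1)).sup' h fun v => cordVal G k true S0 (insert v S1)
    else |bscore G ↑S0 ↑S1|

/-- The (A)-start game cordiality number `c^A_g(G)`. -/
noncomputable def cordA {V : Type*} [Fintype V] (G : SimpleGraph V) : ℤ :=
  cordVal G (Fintype.card V) true ∅ ∅

/-- The (I)-start game cordiality number `c^I_g(G)`. -/
noncomputable def cordI {V : Type*} [Fintype V] (G : SimpleGraph V) : ℤ :=
  cordVal G (Fintype.card V) false ∅ ∅

/-- A position of the balance game with Admirable to move that is safe for Impish with respect to
the pairing `σ`: no pair is monochromatic, every partner of a vertex of Admirable has been answered,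
and at most one unselected vertex has no unselected partner. -/
structure PairingSafe {V : Type*} (σ : V → V) (S0 S1 : Set V) : Prop where
  disjoint : Disjoint S0 S1
  answered : ∀ v ∈ S0, σ v ≠ v → σ v ∈ S1
  not_both : ∀ v ∈ S1, σ v ≠ v → σ v ∉ S1
  single : ∀ v w, v ∉ S0 → v ∉ S1 → w ∉ S0 → w ∉ S1 → (σ v = v ∨ σ v ∈ S1) →
    (σ w = w ∨ σ w ∈ S1) → v = w

/-- The two colour classes cover all vertices and split every pair of `σ`. -/
structure PairingSplit {V : Type*} (σ : V → V) (S0 S1 : Set V) : Prop where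
  disjoint : Disjoint S0 S1
  cover : ∀ v, v ∈ S0 ∨ v ∈ S1
  mem_iff : ∀ v, σ v ≠ v → (σ v ∈ S0 ↔ v ∈ S1)

section Game

variable {V : Type*} {σ : V → V} {S0 S1 : Set V}

theorem PairingSafe.split (h : PairingSafe σ S0 S1) (hσ : Function.Involutive σ)
    (hc : ∀ v, v ∈ S0 ∨ v ∈ S1) : PairingSplit σ S0 S1 := by
  obtain ⟨hd, ha, hn, -⟩ := h
  rw [Set.disjoint_left] at hd
  refine ⟨Set.disjoint_left.2 hd, hc, fun v hv => ⟨fun h0 => ?_, fun h1 => ?_⟩⟩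
  · have := ha _ h0 (by rw [hσ v]; exact hv.symm)
    rwa [hσ v] at this
  · exact (hc _).resolve_right (hn v h1 hv)

/-- After any move of Admirable from a safe position, the game is over with all pairs split, or
Impish can move to a safe position. -/
theorem PairingSafe.reply (h : PairingSafe σ S0 S1) (hσ : Function.Involutive σ)
    {v : V} (h0 : v ∉ S0) (h1 : v ∉ S1) :
    PairingSplit σ (insert v S0) S1 ∨
      ∃ w, w ∉ insert v S0 ∧ w ∉ S1 ∧ PairingSafe σ (insert v S0) (insert w S1) := by
  obtain ⟨hd, ha, hn, hs⟩ := h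
  rw [Set.disjoint_left] at hd
  have hσ' : ∀ z, σ (σ z) = z := hσ
  by_cases hv : σ v = v ∨ σ v ∈ S1
  · by_cases hw : ∃ w, w ∉ insert v S0 ∧ w ∉ S1
    · obtain ⟨w, hw0, hw1⟩ := hw
      refine .inr ⟨w, hw0, hw1, ?_, ?_, ?_, ?_⟩
      · rw [Set.disjoint_left]
        grind
      all_goals grind
    · push Not at hw
      left
      refine PairingSafe.split ⟨?_, ?_, hn, ?_⟩ hσ (by grind)
      · rw [Set.disjoint_left]
        grind
      all_goals grind
  · push Not at hv
    refine .inr ⟨σ v, by grind, hv.2, ?_, ?_, ?_, ?_⟩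
    · rw [Set.disjoint_left]
      grind
    all_goals grind

theorem pairingSafe_empty (hf : ∀ v w, σ v = v → σ w = w → v = w) : PairingSafe σ ∅ ∅ :=
  ⟨by simp, by simp, by simp, by simpa using hf⟩

theorem exists_pairingSafe_singleton [Nonempty V] (hσ : Function.Involutive σ)
    (hf : ∀ v w, σ v = v → σ w = w → v = w) : ∃ w, PairingSafe σ ∅ {w} := by
  have hσ' : ∀ z, σ (σ z) = z := hσ
  by_cases h : ∃ r, σ r = r
  · obtain ⟨r, hr⟩ := h
    refine ⟨r, by simp, by simp, ?_, ?_⟩ <;> grind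
  · obtain ⟨r⟩ := ‹Nonempty V›
    refine ⟨r, by simp, by simp, ?_, ?_⟩ <;> grind

/-- Impish secures a nonnegative score by a pairing strategy for `σ`, as long as every
partition of the vertices splitting the pairs has nonnegative score. -/
theorem gameVal_nonneg_of_pairing [Fintype V] (G : SimpleGraph V) (hσ : Function.Involutive σ)
    (hG : ∀ S0 S1 : Set V, PairingSplit σ S0 S1 → 0 ≤ bscore G S0 S1) (k : ℕ) :
    ∀ S0 S1 : Finset V, Fintype.card V ≤ k + (S0.card + S1.card) →
      (PairingSafe σ (S0 : Set V) S1 → 0 ≤ gameVal G k true S0 S1) ∧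
      (PairingSplit σ (S0 : Set V) S1 ∨
        (Disjoint (S0 : Set V) S1 ∧
          ∃ w, w ∉ S0 ∧ w ∉ S1 ∧ PairingSafe σ (S0 : Set V) (insert w (S1 : Set V))) →
        0 ≤ gameVal G k false S0 S1) := by
  let _ := Classical.decEq V
  induction k with
  | zero =>
    intro S0 S1 hk
    have hc : Disjoint S0 S1 → ∀ v, v ∈ S0 ∨ v ∈ S1 := by
      intro hd v
      rw [← Finset.mem_union]
      have : S0 ∪ S1 = Finset.univ := by
        rw [← Finset.card_eq_iff_eq_univ, Finset.card_union_of_disjoint hd]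
        refine le_antisymm ?_ (by omega)
        rw [← Finset.card_union_of_disjoint hd]
        exact Finset.card_le_univ _
      simp [this]
    refine ⟨fun h => hG _ _ (h.split hσ ?_), ?_⟩
    · exact fun v => by simpa using hc (Finset.disjoint_coe.1 h.disjoint) v
    · rintro (h | ⟨hd, w, h0, h1, h⟩)
      · exact hG _ _ h
      · exact absurd (hc (Finset.disjoint_coe.1 hd) w) (by tauto)
  | succ k ih =>
    intro S0 S1 hk
    constructor
    · intro h
      rw [gameVal]
      by_cases hne : (Finset.univ \ (S0 ∪ S1)).Nonempty
      · rw [dif_pos hne, if_pos rfl, Finset.le_inf'_iff]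
        intro v hv
        simp only [Finset.mem_sdiff, Finset.mem_univ, true_and, Finset.mem_union, not_or] at hv
        refine (ih _ _ ?_).2 ?_
        · rw [Finset.card_insert_of_notMem hv.1]
          omega
        · have hr := h.reply hσ (v := v) (by simpa using hv.1) (by simpa using hv.2)
          have hd : Disjoint (insert v (S0 : Set V)) S1 := by
            simpa [Set.disjoint_insert_left, hv.2] using h.disjoint
          simpa [-Set.disjoint_insert_left, hd] using hr
      · rw [dif_neg hne]
        refine hG _ _ (h.split hσ fun v => ?_)
        by_contra hv
        exact hne ⟨v, by simpa using hv⟩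
    · intro h
      rw [gameVal]
      rcases h with h | ⟨hd, w, h0, h1, h⟩
      · rw [dif_neg]
        · exact hG _ _ h
        · rintro ⟨v, hv⟩
          have := h.cover v
          simp at hv this
          tauto
      · have hw : w ∈ Finset.univ \ (S0 ∪ S1) := by simp [h0, h1]
        have hne : (Finset.univ \ (S0 ∪ S1)).Nonempty := ⟨w, hw⟩
        rw [dif_pos hne, if_neg Bool.false_ne_true, Finset.le_sup'_iff]
        refine ⟨w, hw, (ih _ _ ?_).1 (by simpa using h)⟩
        rw [Finset.card_insert_of_notMem h1]
        omega

end Game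

/-- In a rooted forest given by a parent function that decreases the depth `d` by one, there is a pairing
of every ancestor-closed set `S`, leaving out at most the root, for which the sum of
`x v * x (par v)` is nonpositive whenever `x` takes opposite signs on pairs. -/
theorem exists_pairing_sum_nonpos {V : Type*} [DecidableEq V] (r : V) (par : V → V) (d : V → ℕ)
    (hpar : ∀ v, v ≠ r → d v = d (par v) + 1) (n : ℕ) (S : Finset V) (hn : S.card ≤ n)
    (hS : ∀ v ∈ S, v ≠ r → par v ∈ S) :
    ∃ σ : V → V, Function.Involutive σ ∧ (∀ v ∉ S, σ v = v) ∧ (∀ v ∈ S, σ v = v → v = r) ∧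
      ∀ x : V → ℤ, (∀ v, x v = 1 ∨ x v = -1) → (∀ v, σ v ≠ v → x (σ v) = -x v) →
        ∑ v ∈ S, (if v = r then 0 else x v * x (par v)) ≤ 0 := by
  induction n generalizing S with
  | zero =>
    obtain rfl : S = ∅ := by simpa using hn
    exact ⟨id, fun _ => rfl, by simp, by simp, by simp⟩
  | succ n ih =>
    by_cases hSr : S ⊆ {r}
    · refine ⟨id, fun _ => rfl, by simp, fun v hv _ => by simpa using hSr hv, fun x _ _ => ?_⟩
      refine le_of_eq (Finset.sum_eq_zero fun v hv => ?_)
      simpa using fun h => absurd (by simpa using hSr hv) h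
    have hne : (S.erase r).Nonempty := by
      rw [Finset.nonempty_iff_ne_empty, Ne, Finset.erase_eq_empty_iff]
      rw [Finset.subset_singleton_iff] at hSr
      exact hSr
    obtain ⟨v, hv, hmax⟩ := Finset.exists_max_image _ d hne
    rw [Finset.mem_erase] at hv
    have hleaf : ∀ u, d u = d v → ∀ w ∈ S, w ≠ r → par w ≠ u := by
      rintro u hu w hw hwr rfl
      have := hmax w (Finset.mem_erase.2 ⟨hwr, hw⟩)
      have := hpar w hwr
      omega
    obtain ⟨w, hwS, hwv, hcl, hsum⟩ : ∃ w ∈ S, w ≠ v ∧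
        (∀ u ∈ S, u ≠ r → u ≠ v → u ≠ w → par u ≠ v ∧ par u ≠ w) ∧
        ∀ x : V → ℤ, (∀ v, x v = 1 ∨ x v = -1) → x w = -x v →
          x v * x (par v) + (if w = r then 0 else x w * x (par w)) ≤ 0 := by
      by_cases hsib : ∃ w ∈ S, w ≠ r ∧ w ≠ v ∧ par w = par v
      · obtain ⟨w, hw, hwr, hwv, hp⟩ := hsib
        have hdw : d w = d v := by
          rw [hpar w hwr, hpar v hv.1, hp]
        refine ⟨w, hw, hwv, fun u hu hur _ _ => ⟨hleaf v rfl u hu hur, hleaf w hdw u hu hur⟩,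
          fun x _ hx => ?_⟩
        rw [if_neg hwr, hp, hx]
        linarith
      · push Not at hsib
        refine ⟨par v, hS v hv.2 hv.1, fun h => ?_, fun u hu hur huv _ =>
          ⟨hleaf v rfl u hu hur, hsib u hu hur huv⟩, fun x hx1 hx => ?_⟩
        · have := hpar v hv.1
          rw [h] at this
          omega
        · rw [hx]
          split_ifs
          · rcases hx1 v with h | h <;> simp [h]
          · rcases hx1 v with h | h <;> rcases hx1 (par (par v)) with h' | h' <;> simp [h, h']
    obtain ⟨σ, hσ, hout, hin, hle⟩ := ih ((S.erase w).erase v) (by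
        rw [Finset.card_erase_of_mem (by simp [hv.2, hwv.symm]), Finset.card_erase_of_mem hwS]
        omega) (by
        intro u hu hur
        simp only [Finset.mem_erase] at hu ⊢
        have := hcl u hu.2.2 hur hu.1 hu.2.1
        exact ⟨this.1, this.2, hS u hu.2.2 hur⟩)
    have hσ' : ∀ z, σ (σ z) = z := hσ
    have hσv : σ v = v := hout v (by simp)
    have hσw : σ w = w := hout w (by simp)
    refine ⟨fun z => if z = v then w else if z = w then v else σ z, ?_, ?_, ?_, ?_⟩
    · intro z
      clear hcl hsum hle ih hleaf hS hpar hmax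
      grind
    · intro z hz
      have := hout z (by simp [hz])
      grind
    · intro z hz
      have := hin z
      simp only [Finset.mem_erase] at this
      grind
    · intro x hx1 hx
      rw [← Finset.add_sum_erase _ _ hwS,
        ← Finset.add_sum_erase _ _ (Finset.mem_erase.2 ⟨hwv.symm, hv.2⟩), if_neg hv.1]
      have h1 := hle x hx1 fun z hz => by
        have := hx z
        grind
      have h2 := hsum x hx1 (by simpa [hwv] using hx v (by simpa using hwv))
      linarith

/-- A tree with root `r` has a parent function decreasing the distance to the root, and
counting edges amounts to counting vertices other than the root. -/
theorem SimpleGraph.IsTree.exists_parent {V : Type*} [Fintype V] [DecidableEq V]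
    {T : SimpleGraph V} (hT : T.IsTree) (r : V) :
    ∃ par : V → V, (∀ v, v ≠ r → T.dist v r = T.dist (par v) r + 1) ∧
      ∀ (P : Sym2 V → Prop) [DecidablePred P], ({e ∈ T.edgeSet | P e}.ncard : ℤ) =
        ∑ v, if v = r then 0 else if P s(v, par v) then 1 else 0 := by
  have hex : ∀ v, ∃ u, v ≠ r → T.Adj v u ∧ T.dist v r = T.dist u r + 1 := by
    intro v
    by_cases hv : v = r
    · exact ⟨v, fun h => absurd hv h⟩
    obtain ⟨p, hp⟩ := hT.connected.exists_walk_length_eq_dist v r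
    cases p with
    | nil => exact absurd rfl hv
    | @cons _ u _ h q =>
      refine ⟨u, fun _ => ⟨h, ?_⟩⟩
      have := SimpleGraph.dist_le q
      have := hT.connected.dist_triangle (u := v) (v := u) (w := r)
      rw [SimpleGraph.dist_eq_one_iff_adj.2 h] at this
      rw [SimpleGraph.Walk.length_cons] at hp
      omega
  choose par hpar using hex
  refine ⟨par, fun v hv => (hpar v hv).2, fun P _ => ?_⟩
  have hinj : Set.InjOn (fun v => s(v, par v)) (Finset.univ.erase r : Finset V) := by
    intro v hv w hw h
    simp only [Finset.coe_erase, Finset.coe_univ, Set.mem_sdiff, Set.mem_univ,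
      Set.mem_singleton_iff, true_and] at hv hw
    have h1 := (hpar v hv).2
    have h2 := (hpar w hw).2
    rcases Sym2.eq_iff.1 h with h | ⟨h3, h4⟩
    · exact h.1
    · rw [h4] at h1
      rw [← h3] at h2
      omega
  classical
  have himg : (Finset.univ.erase r).image (fun v => s(v, par v)) = T.edgeFinset := by
    refine Finset.eq_of_subset_of_card_le ?_ ?_
    · intro e he
      obtain ⟨v, hv, rfl⟩ := Finset.mem_image.1 he
      simpa using (hpar v (Finset.ne_of_mem_erase hv)).1
    · rw [Finset.card_image_of_injOn hinj, Finset.card_erase_of_mem (Finset.mem_univ _),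
        Finset.card_univ, ← hT.card_edgeFinset]
      omega
  have hset : {e ∈ T.edgeSet | P e} = (T.edgeFinset.filter P : Finset (Sym2 V)) := by
    ext
    simp
  rw [hset, Set.ncard_coe_finset, Finset.card_filter, ← himg, Finset.sum_image hinj,
    ← Finset.add_sum_erase Finset.univ _ (Finset.mem_univ r), if_pos rfl, zero_add]
  push_cast
  exact Finset.sum_congr rfl fun v hv => by rw [if_neg (Finset.ne_of_mem_erase hv)]

/-- Every finite tree has a pairing of its vertices, with at most one vertex left out, such that
every partition splitting all pairs has nonnegative score. -/
theorem SimpleGraph.IsTree.exists_pairing {V : Type*} [Fintype V] {T : SimpleGraph V}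
    (hT : T.IsTree) :
    ∃ σ : V → V, Function.Involutive σ ∧ (∀ v w, σ v = v → σ w = w → v = w) ∧
      ∀ S0 S1 : Set V, PairingSplit σ S0 S1 → 0 ≤ bscore T S0 S1 := by
  classical
  obtain ⟨r⟩ := hT.connected.nonempty
  obtain ⟨par, hpar, hcount⟩ := hT.exists_parent r
  obtain ⟨σ, hσ, -, hfix, hle⟩ := exists_pairing_sum_nonpos r par (fun v => T.dist v r) hpar _
    Finset.univ le_rfl (by simp)
  refine ⟨σ, hσ, fun v w hv hw => (hfix v (Finset.mem_univ _) hv).trans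
    (hfix w (Finset.mem_univ _) hw).symm, fun S0 S1 h => ?_⟩
  obtain ⟨hd, hc, hm⟩ := h
  rw [Set.disjoint_left] at hd
  have hS1 : ∀ v, v ∈ S1 ↔ v ∉ S0 := fun v =>
    ⟨fun h1 h0 => hd h0 h1, fun h0 => (hc v).resolve_left h0⟩
  have hx := hle (fun v => if v ∈ S0 then 1 else -1) (fun v => by split_ifs <;> simp)
    (fun v hv => by
      have := hm v hv
      rw [hS1] at this
      by_cases h0 : v ∈ S0 <;> simp_all)
  rw [bscore, hcount, hcount, ← Finset.sum_sub_distrib, ← neg_nonpos, ← Finset.sum_neg_distrib]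
  refine le_trans (le_of_eq (Finset.sum_congr rfl fun v _ => ?_)) hx
  by_cases hv : v = r
  · simp [hv]
  have hcut : (∃ u ∈ S0, ∃ w ∈ S1, s(v, par v) = s(u, w)) ↔ ¬ (v ∈ S0 ↔ par v ∈ S0) := by
    simp only [Sym2.eq_iff, hS1]
    grind
  have hmono : ((∃ u ∈ S0, ∃ w ∈ S0, s(v, par v) = s(u, w)) ∨
      ∃ u ∈ S1, ∃ w ∈ S1, s(v, par v) = s(u, w)) ↔ (v ∈ S0 ↔ par v ∈ S0) := by
    simp only [Sym2.eq_iff, hS1]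
    grind
  simp only [hv, hcut, hmono, if_false]
  by_cases h0 : v ∈ S0 <;> by_cases h1 : par v ∈ S0 <;> simp [h0, h1]

theorem statement_10 {V : Type*} [Fintype V] (T : SimpleGraph V) (hT : T.IsTree) :
    0 ≤ balA T ∧ 0 ≤ balI T := by
  obtain ⟨σ, hσ, hfix, hT'⟩ := hT.exists_pairing
  have := hT.connected.nonempty
  obtain ⟨w, hw⟩ := exists_pairingSafe_singleton hσ hfix
  have h := gameVal_nonneg_of_pairing T hσ hT' (Fintype.card V) ∅ ∅ (by simp)
  exact ⟨h.1 (by simpa using pairingSafe_empty hfix), h.2 (.inr ⟨by simp, w, by simpa using hw⟩)⟩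
end

section
/- Let P_n denote the path graph on n vertices. If n is even, then 2⌊n/16⌋ + 1 ≤ b^A_g(P_n) ≤ 4⌈n/16⌉ + 5. If n is odd, then 2⌊n/16⌋ − 4 ≤ b^A_g(P_n) ≤ 4⌈n/16⌉. -/
open SimpleGraph

/-! ### Strategies for a player who always replies -/

section Strategy

variable {V : Type*} [DecidableEq V]

/-- `Ensures Φ F c`: on the free set `F`, with the other vertices coloured by `c`, the player who
replies to each move of the opponent can force a final colouring satisfying `Φ`.
The replying player colours vertices `true` and the opponent colours them `false`. -/
inductive Ensures (Φ : (V → Bool) → Prop) : Finset V → (V → Bool) → Prop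
  | done {c : V → Bool} : Φ c → Ensures Φ ∅ c
  | move {F : Finset V} {c : V → Bool} (hF : F.Nonempty) (f : V → V)
      (hf : ∀ v ∈ F, f v ∈ F.erase v)
      (h : ∀ v ∈ F, Ensures Φ ((F.erase v).erase (f v))
        (Function.update (Function.update c v false) (f v) true)) : Ensures Φ F c

theorem Ensures.of_forall_exists {Φ : (V → Bool) → Prop} {F : Finset V} {c : V → Bool}
    (hF : F.Nonempty) (h : ∀ v ∈ F, ∃ w ∈ F.erase v, Ensures Φ ((F.erase v).erase w)
      (Function.update (Function.update c v false) w true)) : Ensures Φ F c := by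
  choose! f hf hf' using h
  exact .move hF f hf hf'

/-- Final colourings only differ from the current one on the free set. -/
theorem Ensures.mono {Φ Ψ : (V → Bool) → Prop} {F : Finset V} {c : V → Bool}
    (h : Ensures Φ F c) (hΦ : ∀ c', (∀ x ∉ F, c' x = c x) → Φ c' → Ψ c') : Ensures Ψ F c := by
  induction h with
  | done h => exact .done (hΦ _ (fun _ _ => rfl) h)
  | @move F c hF f hf h ih =>
    refine .move hF f hf fun v hv => ih v hv fun c' hc' => hΦ c' fun x hx => ?_
    have hfv := Finset.mem_of_mem_erase (hf v hv)
    rw [hc' x (by simp [hx]), Function.update_of_ne (by rintro rfl; exact hx hfv),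
      Function.update_of_ne (by rintro rfl; exact hx hv)]

theorem Ensures.congr {Φ Ψ : (V → Bool) → Prop} {D F : Finset V} {c d : V → Bool}
    (h : Ensures Φ F c) (hcd : ∀ x ∉ F, x ∉ D → c x = d x)
    (hΦ : ∀ c' d', (∀ x ∉ D, c' x = d' x) → Φ c' → Ψ d') : Ensures Ψ F d := by
  induction h generalizing d with
  | done h => exact .done (hΦ _ _ (fun x hx => hcd x (by simp) hx) h)
  | @move F c hF f hf h ih =>
    refine .move hF f hf fun v hv => ih v hv fun x hx hxD => ?_
    by_cases h1 : x = f v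
    · subst h1; simp
    by_cases h2 : x = v
    · subst h2; simp [Function.update_of_ne h1]
    · simp only [Function.update_of_ne h1, Function.update_of_ne h2]
      exact hcd x (by simpa [h1, h2] using hx) hxD

/-- The colours recorded on the free set are irrelevant. -/
theorem Ensures.congr_free {Φ : (V → Bool) → Prop} {F : Finset V} {c d : V → Bool}
    (h : Ensures Φ F c) (hcd : ∀ x ∉ F, c x = d x) : Ensures Φ F d :=
  h.congr (D := ∅) (fun x hx _ => hcd x hx) fun c' d' h' hc => by
    rwa [← funext fun x => h' x (Finset.notMem_empty x)]

/-- Playing in each of two independent regions separately. -/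
theorem Ensures.and {Φ₁ Φ₂ : (V → Bool) → Prop} {D₁ D₂ F₁ F₂ : Finset V} {c : V → Bool}
    (h₁ : Ensures Φ₁ F₁ c) (h₂ : Ensures Φ₂ F₂ c) (hF₁ : F₁ ⊆ D₁) (hF₂ : F₂ ⊆ D₂)
    (hD : Disjoint D₁ D₂)
    (hΦ₁ : ∀ c d, (∀ x ∉ D₂, c x = d x) → Φ₁ c → Φ₁ d)
    (hΦ₂ : ∀ c d, (∀ x ∉ D₁, c x = d x) → Φ₂ c → Φ₂ d) :
    Ensures (fun c => Φ₁ c ∧ Φ₂ c) (F₁ ∪ F₂) c := by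
  have key : ∀ (D F : Finset V) (Φ : (V → Bool) → Prop) (c : V → Bool) (v w : V),
      v ∈ D → w ∈ D → (∀ c d, (∀ x ∉ D, c x = d x) → Φ c → Φ d) → Ensures Φ F c →
      Ensures Φ F (Function.update (Function.update c v false) w true) := by
    intro D F Φ c v w hv hw hΦ h
    refine h.congr (D := D) (fun x _ hx => ?_) hΦ
    rw [Function.update_of_ne (by rintro rfl; exact hx hw),
      Function.update_of_ne (by rintro rfl; exact hx hv)]
  induction hm : F₁.card + F₂.card using Nat.strong_induction_on generalizing F₁ F₂ c with
  | _ m ih =>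
  by_cases hne : (F₁ ∪ F₂).Nonempty
  · refine .of_forall_exists hne fun v hv => ?_
    rcases Finset.mem_union.1 hv with hv | hv
    · obtain _ | ⟨-, f, hf, h⟩ := h₁
      · simp at hv
      have hfv := Finset.mem_of_mem_erase (hf v hv)
      have hv₂ : v ∉ F₂ := fun h' => Finset.disjoint_left.1 hD (hF₁ hv) (hF₂ h')
      have hw₂ : f v ∉ F₂ := fun h' => Finset.disjoint_left.1 hD (hF₁ hfv) (hF₂ h')
      refine ⟨f v, by rw [Finset.erase_union_distrib]; exact Finset.mem_union_left _ (hf v hv), ?_⟩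
      have := ih (((F₁.erase v).erase (f v)).card + F₂.card) (by
        have h1 := Finset.card_erase_le (s := F₁.erase v) (a := f v)
        have h2 := Finset.card_erase_lt_of_mem hv
        omega) (h v hv) (key D₁ F₂ Φ₂ c v (f v) (hF₁ hv) (hF₁ hfv) hΦ₂ h₂)
        (((Finset.erase_subset _ _).trans (Finset.erase_subset _ _)).trans hF₁) hF₂ rfl
      rwa [Finset.erase_union_distrib, Finset.erase_union_distrib, Finset.erase_eq_of_notMem hv₂,
        Finset.erase_eq_of_notMem hw₂]
    · obtain _ | ⟨-, f, hf, h⟩ := h₂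
      · simp at hv
      have hfv := Finset.mem_of_mem_erase (hf v hv)
      have hv₁ : v ∉ F₁ := fun h' => Finset.disjoint_left.1 hD (hF₁ h') (hF₂ hv)
      have hw₁ : f v ∉ F₁ := fun h' => Finset.disjoint_left.1 hD (hF₁ h') (hF₂ hfv)
      refine ⟨f v, by rw [Finset.erase_union_distrib]; exact Finset.mem_union_right _ (hf v hv), ?_⟩
      have := ih (F₁.card + ((F₂.erase v).erase (f v)).card) (by
        have h1 := Finset.card_erase_le (s := F₂.erase v) (a := f v)
        have h2 := Finset.card_erase_lt_of_mem hv
        omega) (key D₂ F₁ Φ₁ c v (f v) (hF₂ hv) (hF₂ hfv) hΦ₁ h₁) (h v hv) hF₁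
        (((Finset.erase_subset _ _).trans (Finset.erase_subset _ _)).trans hF₂) rfl
      rwa [Finset.erase_union_distrib, Finset.erase_union_distrib, Finset.erase_eq_of_notMem hv₁,
        Finset.erase_eq_of_notMem hw₁]
  · obtain ⟨rfl, rfl⟩ := Finset.union_eq_empty.1 (Finset.not_nonempty_iff_eq_empty.1 hne)
    obtain h₁ | ⟨h, -⟩ := h₁
    · obtain h₂ | ⟨h, -⟩ := h₂
      · exact .done ⟨h₁, h₂⟩
      · simp at h
    · simp at h

/-- `CanForce Φ k b F c`: with `k` moves left on the free set `F`, and the player colouring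
vertices `true` to move exactly when `b = true`, that player can force `Φ`. -/
def CanForce (Φ : (V → Bool) → Prop) : ℕ → Bool → Finset V → (V → Bool) → Prop
  | 0, _, _, c => Φ c
  | k + 1, true, F, c => ∃ v ∈ F, CanForce Φ k false (F.erase v) (Function.update c v true)
  | k + 1, false, F, c => ∀ v ∈ F, CanForce Φ k true (F.erase v) (Function.update c v false)

theorem Ensures.canForce_false {Φ : (V → Bool) → Prop} {F : Finset V} {c : V → Bool}
    (h : Ensures Φ F c) : CanForce Φ F.card false F c := by
  induction h with
  | done h => exact h
  | @move F c hF f hf h ih =>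
    obtain ⟨k, hk⟩ : ∃ k, F.card = k + 2 := by
      obtain ⟨v, hv⟩ := hF
      have h1 := Finset.card_erase_add_one hv
      have h2 := Finset.card_erase_add_one (hf v hv)
      exact ⟨_, by rw [← h1, ← h2]⟩
    rw [hk]
    intro v hv
    refine ⟨f v, hf v hv, ?_⟩
    have h1 := Finset.card_erase_add_one hv
    have h2 := Finset.card_erase_add_one (hf v hv)
    have := ih v hv
    rwa [show ((F.erase v).erase (f v)).card = k by omega] at this

/-- Owning a vertex of the free set in advance does not harm the replying player. -/
theorem Ensures.canForce_erase {Φ : (V → Bool) → Prop} {F : Finset V} {c : V → Bool}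
    (h : Ensures Φ F c) {w : V} (hw : w ∈ F) {k : ℕ} (hk : F.card = k + 1) :
    CanForce Φ k false (F.erase w) (Function.update c w true) := by
  induction h generalizing w k with
  | done h => simp at hw
  | @move F c hF f hf h ih =>
    obtain ⟨k, rfl⟩ : ∃ j, k = j + 1 := by
      have h1 := Finset.card_erase_add_one hw
      have h2 := Finset.card_erase_add_one (hf w hw)
      exact ⟨k - 1, by omega⟩
    intro v hv
    obtain ⟨hvw, hvF⟩ := Finset.mem_erase.1 hv
    obtain ⟨hfv, -⟩ := Finset.mem_erase.1 (hf v hvF)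
    have h1 := Finset.card_erase_add_one hvF
    have h2 := Finset.card_erase_add_one (hf v hvF)
    rw [Finset.erase_right_comm, Function.update_comm hvw.symm]
    by_cases hfw : f v = w
    · have hE := h v hvF
      have ih' := @ih v hvF
      rw [hfw] at hE h2 ih'
      obtain hemp | ⟨u, hu⟩ := ((F.erase v).erase w).eq_empty_or_nonempty
      · rw [hemp] at hE h2 ⊢
        obtain rfl : k = 0 := by simp at h2; omega
        obtain h' | ⟨h', -⟩ := hE
        · exact h'
        · simp at h'
      · have h3 := Finset.card_erase_add_one hu
        obtain ⟨k, rfl⟩ : ∃ j, k = j + 1 := ⟨k - 1, by omega⟩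
        exact ⟨u, hu, ih' hu (by omega)⟩
    · have hw' : w ∈ (F.erase v).erase (f v) := by simp [hw, hvw.symm, Ne.symm hfw]
      have h3 := Finset.card_erase_add_one hw'
      obtain ⟨k, rfl⟩ : ∃ j, k = j + 1 := ⟨k - 1, by omega⟩
      refine ⟨f v, Finset.mem_erase.2 ⟨hfw, hf v hvF⟩, ?_⟩
      rw [Finset.erase_right_comm, Function.update_comm (Ne.symm hfw)]
      exact ih v hvF hw' (by omega)

theorem Ensures.canForce_true {Φ : (V → Bool) → Prop} {F : Finset V} {c : V → Bool}
    (h : Ensures Φ F c) : CanForce Φ F.card true F c := by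
  obtain rfl | ⟨w, hw⟩ := F.eq_empty_or_nonempty
  · obtain h' | ⟨h', -⟩ := h
    · exact h'
    · simp at h'
  · rw [← Finset.card_erase_add_one hw]
    exact ⟨w, hw, h.canForce_erase hw (Finset.card_erase_add_one hw).symm⟩

/-- An additional free vertex that the strategy always concedes to the opponent. -/
theorem Ensures.canForce_insert {Φ : (V → Bool) → Prop} {F : Finset V} {c : V → Bool}
    (h : Ensures Φ F c) {z : V} (hz : z ∉ F) (hc : c z = false) :
    CanForce Φ (F.card + 1) false (insert z F) c := by
  have hzc : ∀ {c : V → Bool}, c z = false → Function.update c z false = c :=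
    fun h => Function.update_eq_self_iff.2 h.symm
  induction h with
  | @done c h =>
    intro v hv
    obtain rfl : v = z := by simpa using hv
    change Φ _
    rwa [hzc hc]
  | @move F c hF f hf h ih =>
    intro v hv
    by_cases hvz : v = z
    · subst hvz
      rw [hzc hc, Finset.erase_insert hz]
      exact (Ensures.move hF f hf h).canForce_true
    · have hvF : v ∈ F := Finset.mem_of_mem_insert_of_ne hv hvz
      have h1 := Finset.card_erase_add_one hvF
      have h2 := Finset.card_erase_add_one (hf v hvF)
      have hfz : f v ≠ z := fun e => hz (e ▸ Finset.mem_of_mem_erase (hf v hvF))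
      rw [Finset.erase_insert_of_ne (Ne.symm hvz), ← h1]
      refine ⟨f v, Finset.mem_insert_of_mem (hf v hvF), ?_⟩
      rw [Finset.erase_insert_of_ne hfz.symm, ← h2]
      refine ih v hvF (by simp [hz]) ?_
      rw [Function.update_of_ne hfz.symm, Function.update_of_ne (Ne.symm hvz), hc]

end Strategy

/-! ### From strategies to game values -/

section GameValue

variable {V : Type*} [Fintype V] [DecidableEq V] (G : SimpleGraph V)

/-- The vertices outside `F` that `c` colours with `b`. -/
def colorClass (F : Finset V) (c : V → Bool) (b : Bool) : Finset V :=
  Finset.univ.filter fun v => v ∉ F ∧ c v = b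

theorem univ_sdiff_colorClass (F : Finset V) (c : V → Bool) (b : Bool) :
    Finset.univ \ (colorClass F c b ∪ colorClass F c !b) = F := by
  ext v
  by_cases hv : v ∈ F <;> cases h : c v <;> cases b <;> simp [colorClass, hv, h]

theorem colorClass_erase_update_self {F : Finset V} (c : V → Bool) {v : V} (hv : v ∈ F)
    (b : Bool) :
    colorClass (F.erase v) (Function.update c v b) b = insert v (colorClass F c b) := by
  ext u
  by_cases h : u = v
  · subst h; simp [colorClass]
  · simp [colorClass, h]

theorem colorClass_erase_update_not {F : Finset V} (c : V → Bool) {v : V} (hv : v ∈ F)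
    (b : Bool) :
    colorClass (F.erase v) (Function.update c v b) (!b) = colorClass F c !b := by
  ext u
  by_cases h : u = v
  · subst h; simp [colorClass, hv]
  · simp [colorClass, h]

theorem gameVal_succ (k : ℕ) (t : Bool) {F S0 S1 : Finset V} (hF : F.Nonempty)
    (h : Finset.univ \ (S0 ∪ S1) = F) :
    gameVal G (k + 1) t S0 S1 =
      if t then F.inf' hF fun v => gameVal G k false (insert v S0) S1
      else F.sup' hF fun v => gameVal G k true S0 (insert v S1) := by
  subst h
  obtain rfl : ‹DecidableEq V› = Classical.decEq V := Subsingleton.elim _ _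
  exact dif_pos hF

theorem CanForce.le_gameVal {T : ℤ} {k : ℕ} {b : Bool} {F : Finset V} {c : V → Bool}
    (hk : F.card = k)
    (h : CanForce (fun c => T ≤ bscore G {v | c v = false} {v | c v = true}) k b F c) :
    T ≤ gameVal G k (!b) (colorClass F c false) (colorClass F c true) := by
  induction k generalizing b F c with
  | zero =>
    obtain rfl := Finset.card_eq_zero.1 hk
    simpa [gameVal, colorClass, CanForce] using h
  | succ k ih =>
    have hF : F.Nonempty := Finset.card_pos.1 (by omega)
    rw [gameVal_succ G k _ hF
      (show Finset.univ \ (colorClass F c false ∪ colorClass F c true) = F from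
        univ_sdiff_colorClass F c false)]
    cases b with
    | true =>
      obtain ⟨v, hv, h⟩ := h
      have := ih (by rw [Finset.card_erase_of_mem hv, hk]; rfl) h
      rw [colorClass_erase_update_self c hv true] at this
      have e := colorClass_erase_update_not c hv true
      simp only [Bool.not_true] at e this ⊢
      rw [e] at this
      simp only [Bool.false_eq_true, if_false]
      exact Finset.le_sup'_of_le _ hv (by simpa using this)
    | false =>
      simp only [Bool.not_false, if_true]
      refine Finset.le_inf' _ _ fun v hv => ?_
      have := ih (by rw [Finset.card_erase_of_mem hv, hk]; rfl) (h v hv)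
      rw [colorClass_erase_update_self c hv false] at this
      have e := colorClass_erase_update_not c hv false
      simp only [Bool.not_false, Bool.not_true] at e this
      rwa [e] at this

theorem CanForce.gameVal_le {T : ℤ} {k : ℕ} {b : Bool} {F : Finset V} {c : V → Bool}
    (hk : F.card = k)
    (h : CanForce (fun c => bscore G {v | c v = true} {v | c v = false} ≤ T) k b F c) :
    gameVal G k b (colorClass F c true) (colorClass F c false) ≤ T := by
  induction k generalizing b F c with
  | zero =>
    obtain rfl := Finset.card_eq_zero.1 hk
    simpa [gameVal, colorClass, CanForce] using h
  | succ k ih =>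
    have hF : F.Nonempty := Finset.card_pos.1 (by omega)
    rw [gameVal_succ G k _ hF
      (show Finset.univ \ (colorClass F c true ∪ colorClass F c false) = F from
        univ_sdiff_colorClass F c true)]
    cases b with
    | true =>
      obtain ⟨v, hv, h⟩ := h
      have := ih (by rw [Finset.card_erase_of_mem hv, hk]; rfl) h
      rw [colorClass_erase_update_self c hv true] at this
      have e := colorClass_erase_update_not c hv true
      simp only [Bool.not_true] at e
      rw [e] at this
      exact Finset.inf'_le_of_le _ hv this
    | false =>
      simp only [Bool.false_eq_true, if_false]
      refine Finset.sup'_le _ _ fun v hv => ?_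
      have := ih (by rw [Finset.card_erase_of_mem hv, hk]; rfl) (h v hv)
      rw [colorClass_erase_update_self c hv false] at this
      have e := colorClass_erase_update_not c hv false
      simp only [Bool.not_false] at e
      rwa [e] at this

theorem CanForce.le_balA {T : ℤ} {c : V → Bool}
    (h : CanForce (fun c => T ≤ bscore G {v | c v = false} {v | c v = true})
      (Fintype.card V) false Finset.univ c) : T ≤ balA G := by
  simpa [balA, colorClass] using h.le_gameVal G Finset.card_univ

theorem CanForce.balA_le {T : ℤ} {c : V → Bool}
    (h : CanForce (fun c => bscore G {v | c v = true} {v | c v = false} ≤ T)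
      (Fintype.card V) true Finset.univ c) : balA G ≤ T := by
  simpa [balA, colorClass] using h.gameVal_le G Finset.card_univ

end GameValue

/-! ### Segments of a partially coloured path -/

section Segments

variable {V : Type*}

/-- The sign `1` of the replying player, or `-1` of the opponent. -/
def colorSign (b : Bool) : ℤ := if b then 1 else -1

/-- The sum of `s * a * b` over consecutive entries `a`, `b` of the sequence that starts with `l`,
continues with the signs of the vertices in `us` and ends with `r`. -/
def payoff (s : ℤ) (c : V → Bool) : ℤ → List V → ℤ → ℤ
  | l, [], r => s * l * r
  | l, u :: us, r => s * l * colorSign (c u) + payoff s c (colorSign (c u)) us r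

variable (s : ℤ) (c : V → Bool)

theorem payoff_append_cons (l r : ℤ) (us us' : List V) (v : V) :
    payoff s c l (us ++ v :: us') r =
      payoff s c l us (colorSign (c v)) + payoff s c (colorSign (c v)) us' r := by
  induction us generalizing l with
  | nil => rfl
  | cons u us ih => simp only [List.cons_append, payoff, ih, add_assoc]

theorem payoff_reverse (l r : ℤ) (us : List V) :
    payoff s c l us.reverse r = payoff s c r us l := by
  induction us generalizing r with
  | nil => simp only [List.reverse_nil, payoff]; ring
  | cons u us ih =>
    rw [List.reverse_cons, payoff_append_cons, ih]
    simp only [payoff]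
    ring

theorem payoff_congr {c d : V → Bool} (l r : ℤ) {us : List V} (h : ∀ u ∈ us, c u = d u) :
    payoff s c l us r = payoff s d l us r := by
  induction us generalizing l with
  | nil => rfl
  | cons u us ih =>
    simp only [payoff, h u List.mem_cons_self, ih _ fun v hv => h v (List.mem_cons_of_mem _ hv)]

theorem abs_colorSign (b : Bool) : |colorSign b| = 1 := by cases b <;> rfl

theorem payoff_zero_left_le {s : ℤ} (hs : |s| = 1) {l : ℤ} (hl : |l| ≤ 1) (us : List V) :
    payoff s c 0 us 0 - 1 ≤ payoff s c l us 0 := by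
  cases us with
  | nil => simp [payoff]
  | cons u us =>
    have : |s * l * colorSign (c u)| ≤ 1 := by simpa [abs_mul, hs, abs_colorSign] using hl
    have := (abs_le.1 this).1
    simp only [payoff]
    linarith

theorem payoff_append_ge {s : ℤ} (hs : |s| = 1) {l : ℤ} (hl : |l| ≤ 1) (us us' : List V) :
    payoff s c l us 0 + payoff s c 0 us' 0 - 1 ≤ payoff s c l (us ++ us') 0 := by
  induction us generalizing l with
  | nil => simpa [payoff] using payoff_zero_left_le c hs hl us'
  | cons u us ih =>
    have := ih (abs_colorSign (c u)).le
    simp only [List.cons_append, payoff]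
    linarith

/-- A segment of free vertices is encoded by the number `9 * n + 3 * l + r`, where `n` is its
length and `l`, `r` describe what precedes and follows it: `0` for a vertex of the opponent, `1` for
nothing and `2` for a vertex of the replying player. -/
def leftSign (n : ℕ) : ℤ := (n / 3 % 3 : ℕ) - 1

/-- The sign following the segment encoded by `n`. -/
def rightSign (n : ℕ) : ℤ := (n % 3 : ℕ) - 1

/-- The vertices of a multiset of segments. -/
def segVertices (R : Multiset (ℕ × List V)) : Multiset V := R.bind fun x => (x.2 : Multiset V)

/-- The total payoff of a multiset of segments. -/
def segPayoff (R : Multiset (ℕ × List V)) : ℤ :=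
  (R.map fun x => payoff s c (leftSign x.1) x.2 (rightSign x.1)).sum

theorem segPayoff_cons (x : ℕ × List V) (R : Multiset (ℕ × List V)) :
    segPayoff s c (x ::ₘ R) =
      payoff s c (leftSign x.1) x.2 (rightSign x.1) + segPayoff s c R := by
  simp [segPayoff]

theorem segVertices_cons (x : ℕ × List V) (R : Multiset (ℕ × List V)) :
    segVertices (x ::ₘ R) = ↑x.2 + segVertices R := by
  simp [segVertices]

variable [DecidableEq V]

/-- On every collection of segments with the shapes in `G`, the replying player can force a payoff
of at least `t`. -/
def Attains (V : Type*) [DecidableEq V] (s : ℤ) (G : Multiset ℕ) (t : ℤ) : Prop :=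
  ∀ (R : Multiset (ℕ × List V)) (F : Finset V) (c : V → Bool), R.map Prod.fst = G →
    (∀ x ∈ R, x.2.length = x.1 / 9) → F.val = segVertices R →
    Ensures (fun c => t ≤ segPayoff s c R) F c

variable {s : ℤ}

theorem Attains.mono {G : Multiset ℕ} {t t' : ℤ} (h : Attains V s G t) (ht : t' ≤ t) :
    Attains V s G t' :=
  fun R F c hR hl hF => (h R F c hR hl hF).mono fun _ _ h => ht.trans h

theorem Attains.zero : Attains V s 0 0 := by
  intro R F c hR hl hF
  obtain rfl := Multiset.map_eq_zero.1 hR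
  obtain rfl : F = ∅ := by simpa [segVertices] using hF
  exact .done (by simp [segPayoff])

theorem Attains.cons_of_lt {G : Multiset ℕ} {t : ℤ} (h : Attains V s G t) {n : ℕ} (hn : n < 9) :
    Attains V s (n ::ₘ G) (t + s * leftSign n * rightSign n) := by
  intro R F c hR hl hF
  obtain ⟨⟨m, us⟩, hx, rfl, hG⟩ := (Multiset.map_eq_cons _ _ _ _).2 hR
  obtain ⟨R, rfl⟩ := Multiset.exists_cons_of_mem hx
  obtain rfl : us = [] := List.length_eq_zero_iff.1 ((hl _ hx).trans (Nat.div_eq_of_lt hn))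
  rw [Multiset.erase_cons_head] at hG
  refine (h R F c hG (fun x hx => hl x (Multiset.mem_cons_of_mem hx))
    (by simpa [segVertices_cons] using hF)).mono fun c' _ h' => ?_
  rw [segPayoff_cons]
  simp only [payoff]
  linarith

/-- Reversing a segment so that the larger boundary code comes last. -/
def flipSeg (n : ℕ) : ℕ :=
  bif Nat.ble (n / 3 % 3) (n % 3) then n else 9 * (n / 9) + 3 * (n % 3) + n / 3 % 3

theorem Attains.of_flipSeg {G : Multiset ℕ} {t : ℤ} {n : ℕ}
    (h : Attains V s (flipSeg n ::ₘ G) t) : Attains V s (n ::ₘ G) t := by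
  rw [flipSeg] at h
  cases hle : Nat.ble (n / 3 % 3) (n % 3) with
  | true => simpa only [hle, cond_true] using h
  | false =>
    simp only [hle, cond_false] at h
    intro R F c hR hl hF
    obtain ⟨⟨m, us⟩, hx, rfl, hG⟩ := (Multiset.map_eq_cons _ _ _ _).2 hR
    obtain ⟨R, rfl⟩ := Multiset.exists_cons_of_mem hx
    rw [Multiset.erase_cons_head] at hG
    have hlen := hl _ hx
    refine (h ((_, us.reverse) ::ₘ R) F c (by rw [Multiset.map_cons, hG]) ?_ ?_).mono
      fun c' _ h' => ?_
    · intro x hx'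
      rcases Multiset.mem_cons.1 hx' with rfl | hx'
      · simp only [List.length_reverse] at hlen ⊢; omega
      · exact hl x (Multiset.mem_cons_of_mem hx')
    · rw [hF, segVertices_cons, segVertices_cons]
      simp
    · rw [segPayoff_cons] at h' ⊢
      have h₁ : leftSign (9 * (m / 9) + 3 * (m % 3) + m / 3 % 3) = rightSign m := by
        have : (9 * (m / 9) + 3 * (m % 3) + m / 3 % 3) / 3 = 3 * (m / 9) + m % 3 := by omega
        simp only [leftSign, rightSign, this]; omega
      have h₂ : rightSign (9 * (m / 9) + 3 * (m % 3) + m / 3 % 3) = leftSign m := by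
        simp only [leftSign, rightSign]; omega
      rwa [payoff_reverse, h₁, h₂] at h'

/-- Sorted insertion. This and the other functions evaluated by the kernel below are written with
recursors, which the kernel unfolds faster than compiled pattern matching. -/
noncomputable def insertSeg (n : ℕ) (g : List ℕ) : List ℕ :=
  List.rec [n] (fun a g ih => bif Nat.ble n a then n :: a :: g else a :: ih) g

theorem insertSeg_cons (n a : ℕ) (g : List ℕ) :
    insertSeg n (a :: g) = bif Nat.ble n a then n :: a :: g else a :: insertSeg n g :=
  rfl

theorem coe_insertSeg (n : ℕ) (g : List ℕ) : (insertSeg n g : Multiset ℕ) = n ::ₘ ↑g := by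
  induction g with
  | nil => rfl
  | cons a g ih =>
    rw [insertSeg_cons]
    cases Nat.ble n a with
    | true => rfl
    | false =>
      rw [cond_false, ← Multiset.cons_coe, ih, Multiset.cons_swap, Multiset.cons_coe]

/-- Removes the empty segments and brings the others into a canonical order. -/
noncomputable def canonSegs (g : List ℕ) : List ℕ :=
  List.rec [] (fun n _ ih => bif Nat.blt n 9 then ih else insertSeg (flipSeg n) ih) g

theorem canonSegs_cons (n : ℕ) (g : List ℕ) : canonSegs (n :: g) =
    bif Nat.blt n 9 then canonSegs g else insertSeg (flipSeg n) (canonSegs g) :=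
  rfl

/-- The total payoff of the empty segments. -/
def closedPayoff (s : ℤ) : List ℕ → ℤ
  | [] => 0
  | n :: g => (if n < 9 then s * leftSign n * rightSign n else 0) + closedPayoff s g

theorem Attains.of_canonSegs_add {g : List ℕ} {G : Multiset ℕ} {t : ℤ}
    (h : Attains V s (↑(canonSegs g) + G) t) : Attains V s (↑g + G) (t + closedPayoff s g) := by
  induction g generalizing G t with
  | nil => simpa [canonSegs, closedPayoff] using h
  | cons n g ih =>
    rw [canonSegs_cons] at h
    rw [closedPayoff]
    by_cases hn : n < 9
    · rw [Nat.blt_eq.mpr hn, cond_true] at h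
      rw [if_pos hn, ← Multiset.cons_coe, Multiset.cons_add]
      exact ((ih h).cons_of_lt hn).mono (by linarith)
    · rw [Bool.eq_false_iff.2 (mt Nat.blt_eq.mp hn), cond_false, coe_insertSeg, Multiset.cons_add,
        ← Multiset.add_cons] at h
      rw [if_neg hn, zero_add, ← Multiset.cons_coe, Multiset.cons_add]
      refine Attains.of_flipSeg ?_
      rw [← Multiset.add_cons]
      exact ih h

theorem Attains.of_canonSegs {g : List ℕ} {t : ℤ} (h : Attains V s ↑(canonSegs g) t) :
    Attains V s ↑g (t + closedPayoff s g) := by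
  simpa using Attains.of_canonSegs_add (G := 0) (by simpa using h)

/-- The number of vertices in a list of segments. -/
noncomputable def segSize (g : List ℕ) : ℕ :=
  List.rec 0 (fun n _ ih => n / 9 + ih) g

theorem segSize_cons (n : ℕ) (g : List ℕ) : segSize (n :: g) = n / 9 + segSize g := rfl

/-- The value `f n`, set up so that the kernel evaluates `n` before it unfolds `f`. -/
noncomputable def evalArg {α : Type} (n : ℕ) (f : ℕ → α) : α :=
  Nat.rec (f 0) (fun n _ => f n.succ) n

theorem evalArg_eq {α : Type} (n : ℕ) (f : ℕ → α) : evalArg n f = f n := by cases n <;> rfl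

/-- The segments that remain after the `p`-th vertex of `g` gets the colour encoded by `x`. -/
noncomputable def playSegs (x : ℕ) (g : List ℕ) : ℕ → List ℕ :=
  List.rec (fun _ => []) (fun n g ih p => bif Nat.blt p (n / 9)
    then evalArg (9 * p + 3 * (n / 3 % 3) + x) fun a =>
      evalArg (9 * (n / 9 - 1 - p) + 3 * x + n % 3) fun b => a :: b :: g
    else n :: ih (p - n / 9)) g

theorem playSegs_cons (x n : ℕ) (g : List ℕ) (p : ℕ) :
    playSegs x (n :: g) p = bif Nat.blt p (n / 9)
      then (9 * p + 3 * (n / 3 % 3) + x) :: (9 * (n / 9 - 1 - p) + 3 * x + n % 3) :: g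
      else n :: playSegs x g (p - n / 9) := by
  have : playSegs x (n :: g) p = bif Nat.blt p (n / 9)
      then evalArg (9 * p + 3 * (n / 3 % 3) + x) fun a =>
        evalArg (9 * (n / 9 - 1 - p) + 3 * x + n % 3) fun b => a :: b :: g
      else n :: playSegs x g (p - n / 9) := rfl
  rw [this, evalArg_eq, evalArg_eq]

/-- The two segments left when the `i`-th vertex of the segment `n` gets the colour `x`. -/
def splitSeg (x n i : ℕ) : Multiset ℕ :=
  {9 * i + 3 * (n / 3 % 3) + x, 9 * (n / 9 - 1 - i) + 3 * x + n % 3}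

theorem exists_playSegs_eq (x : ℕ) {g : List ℕ} {n i : ℕ} (hn : n ∈ g) (hi : i < n / 9) :
    ∃ p < segSize g, (playSegs x g p : Multiset ℕ) = splitSeg x n i + (g : Multiset ℕ).erase n := by
  induction g with
  | nil => simp at hn
  | cons m g ih =>
    by_cases hmn : m = n
    · subst hmn
      refine ⟨i, by rw [segSize_cons]; omega, ?_⟩
      rw [playSegs_cons, Nat.blt_eq.mpr hi, cond_true, ← Multiset.cons_coe m,
        Multiset.erase_cons_head]
      rfl
    · obtain ⟨p, hp, h⟩ := ih ((List.mem_cons.1 hn).resolve_left (Ne.symm hmn))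
      refine ⟨p + m / 9, by rw [segSize_cons]; omega, ?_⟩
      rw [playSegs_cons, Bool.eq_false_iff.2 (mt Nat.blt_eq.mp (by omega)), cond_false,
        Nat.add_sub_cancel, ← Multiset.cons_coe, ← Multiset.cons_coe, h,
        Multiset.erase_cons_tail _ (by simpa using hmn), Multiset.add_cons]

theorem playSegs_eq (x : ℕ) {g : List ℕ} {p : ℕ} (hp : p < segSize g) :
    ∃ n ∈ g, ∃ i < n / 9,
      (playSegs x g p : Multiset ℕ) = splitSeg x n i + (g : Multiset ℕ).erase n := by
  induction g generalizing p with
  | nil => simp [segSize] at hp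
  | cons m g ih =>
    by_cases hm : p < m / 9
    · refine ⟨m, List.mem_cons_self, p, hm, ?_⟩
      rw [playSegs_cons, Nat.blt_eq.mpr hm, cond_true, ← Multiset.cons_coe m,
        Multiset.erase_cons_head]
      rfl
    · rw [segSize_cons] at hp
      obtain ⟨n, hn, i, hi, h⟩ := ih (p := p - m / 9) (by omega)
      refine ⟨n, List.mem_cons_of_mem _ hn, i, hi, ?_⟩
      rw [playSegs_cons, Bool.eq_false_iff.2 (mt Nat.blt_eq.mp hm), cond_false, ← Multiset.cons_coe, h,
        ← Multiset.cons_coe, ← Multiset.add_cons]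
      by_cases hmn : m = n
      · rw [hmn, Multiset.erase_cons_head, Multiset.cons_erase (Multiset.mem_coe.2 hn)]
      · rw [Multiset.erase_cons_tail _ (by simpa using hmn)]

/-- Colouring one vertex of a collection of segments. -/
theorem exists_split {R : Multiset (ℕ × List V)} {F : Finset V}
    (hl : ∀ x ∈ R, x.2.length = x.1 / 9) (hF : F.val = segVertices R) {x : ℕ × List V}
    (hx : x ∈ R) {i : ℕ} (hi : i < x.2.length) (b : Bool) :
    x.2[i] ∈ F ∧ ∃ R' : Multiset (ℕ × List V),
      R'.map Prod.fst = splitSeg (cond b 2 0) x.1 i + (R.map Prod.fst).erase x.1 ∧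
      (∀ x ∈ R', x.2.length = x.1 / 9) ∧ (F.erase x.2[i]).val = segVertices R' ∧
      ∀ c : V → Bool, c x.2[i] = b → segPayoff s c R' = segPayoff s c R := by
  obtain ⟨R, rfl⟩ := Multiset.exists_cons_of_mem hx
  obtain ⟨n, us⟩ := x
  have hlen := hl _ hx
  dsimp only at hlen hi ⊢
  have hus : us.take i ++ us[i] :: us.drop (i + 1) = us := by simp
  have hb : ∃ a : ℕ, a ≤ 2 ∧ cond b 2 0 = a ∧ ((a : ℤ) - 1) = colorSign b := by
    cases b
    · exact ⟨0, by simp [colorSign]⟩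
    · exact ⟨2, by simp [colorSign]⟩
  obtain ⟨a, ha, hab, hab'⟩ := hb
  rw [hab]
  refine ⟨?_, (9 * i + 3 * (n / 3 % 3) + a, us.take i) ::ₘ
    (9 * (n / 9 - 1 - i) + 3 * a + n % 3, us.drop (i + 1)) ::ₘ R, ?_, ?_, ?_, ?_⟩
  · rw [← Finset.mem_val, hF, segVertices_cons]
    simp
  · simp [splitSeg]
  · intro x hx'
    simp only [Multiset.mem_cons] at hx'
    rcases hx' with rfl | rfl | hx'
    · simp only [List.length_take]; omega
    · simp only [List.length_drop]; omega
    · exact hl x (Multiset.mem_cons_of_mem hx')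
  · have : (us : Multiset V) = us[i] ::ₘ (↑(us.take i) + ↑(us.drop (i + 1))) := by
      conv_lhs => rw [← hus]
      rw [← Multiset.coe_add, ← Multiset.cons_coe, Multiset.add_cons]
    rw [Finset.erase_val, hF, segVertices_cons, segVertices_cons, segVertices_cons]
    dsimp only
    rw [this, Multiset.cons_add, Multiset.erase_cons_head, add_assoc]
  · intro c hc
    rw [segPayoff_cons, segPayoff_cons, segPayoff_cons]
    dsimp only
    conv_rhs => rw [← hus, payoff_append_cons, hc, ← hab', add_assoc]
    have h₁ : leftSign (9 * i + 3 * (n / 3 % 3) + a) = leftSign n := by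
      simp only [leftSign]; omega
    have h₂ : rightSign (9 * i + 3 * (n / 3 % 3) + a) = a - 1 := by
      simp only [rightSign]; omega
    have h₃ : leftSign (9 * (n / 9 - 1 - i) + 3 * a + n % 3) = a - 1 := by
      simp only [leftSign]; omega
    have h₄ : rightSign (9 * (n / 9 - 1 - i) + 3 * a + n % 3) = rightSign n := by
      simp only [rightSign]; omega
    rw [h₁, h₂, h₃, h₄]

theorem Attains.of_forall_exists {g : List ℕ} {t : ℤ} (hg : 0 < segSize g)
    (h : ∀ p < segSize g, ∃ q < segSize (playSegs 0 g p),
      Attains V s ↑(playSegs 2 (playSegs 0 g p) q) t) : Attains V s ↑g t := by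
  intro R F c hR hl hF
  have hne : F.Nonempty := by
    obtain ⟨n, hn, i, hi, -⟩ := playSegs_eq 0 hg
    rw [← Multiset.mem_coe, ← hR] at hn
    obtain ⟨x, hx, rfl⟩ := Multiset.mem_map.1 hn
    exact ⟨_, (exists_split (s := s) hl hF hx ((hl x hx).symm ▸ hi) true).1⟩
  refine .of_forall_exists hne fun v hv => ?_
  rw [← Finset.mem_val, hF, segVertices, Multiset.mem_bind] at hv
  obtain ⟨x, hx, hv⟩ := hv
  obtain ⟨i, hi, rfl⟩ := List.mem_iff_getElem.1 (Multiset.mem_coe.1 hv)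
  obtain ⟨-, R₁, hR₁, hl₁, hF₁, hp₁⟩ := exists_split (s := s) hl hF hx hi false
  obtain ⟨p, hp, hgp⟩ := exists_playSegs_eq 0 (g := g)
    (Multiset.mem_coe.1 (hR ▸ Multiset.mem_map_of_mem Prod.fst hx)) ((hl x hx) ▸ hi)
  obtain ⟨q, hq, hA⟩ := h p hp
  obtain ⟨n, hn, j, hj, hgq⟩ := playSegs_eq 2 hq
  rw [hR] at hR₁
  rw [← Multiset.mem_coe, hgp] at hn
  rw [hgq, hgp] at hA
  rw [cond_false] at hR₁
  rw [← hR₁] at hn hA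
  obtain ⟨y, hy, rfl⟩ := Multiset.mem_map.1 hn
  obtain ⟨hw, R₂, hR₂, hl₂, hF₂, hp₂⟩ :=
    exists_split (s := s) hl₁ hF₁ hy ((hl₁ y hy).symm ▸ hj) true
  refine ⟨_, hw, (hA R₂ _ _ hR₂ hl₂ hF₂).mono fun c' hc' hc => ?_⟩
  rw [← hp₁ c', ← hp₂ c']
  · exact hc
  · rw [hc' _ (by simp), Function.update_self]
  · rw [hc' _ (by simp), Function.update_of_ne (Finset.ne_of_mem_erase hw).symm,
      Function.update_self]

/-- Two disjoint uncoloured paths joined by one edge. -/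
theorem Attains.join {m n : ℕ} {t t' : ℤ} (hs : |s| = 1) (hm : Attains V s {9 * m + 4} t)
    (hn : Attains V s {9 * n + 4} t') : Attains V s {9 * (m + n) + 4} (t + t' - 1) := by
  intro R F c hR hl hF
  obtain ⟨⟨k, us⟩, rfl, hk⟩ := Multiset.map_eq_singleton.1 hR
  obtain rfl : k = 9 * (m + n) + 4 := hk
  have hlen : us.length = m + n := by
    have := hl _ (Multiset.mem_singleton_self _)
    dsimp only at this
    omega
  have hsign : ∀ k, leftSign (9 * k + 4) = 0 ∧ rightSign (9 * k + 4) = 0 := by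
    intro k; simp only [leftSign, rightSign]; omega
  have hcells : ∀ (k : ℕ) (us : List V), segVertices {(k, us)} = ↑us := by
    intro k us; simp [segVertices]
  have hpay : ∀ (c : V → Bool) (k : ℕ) (us : List V),
      segPayoff s c {(9 * k + 4, us)} = payoff s c 0 us 0 := by
    intro c k us; simp [segPayoff, hsign]
  rw [hcells] at hF
  have hnd : us.Nodup := by have := F.nodup; rwa [hF] at this
  rw [← List.take_append_drop m us] at hnd hF
  have hsplit := hnd.of_append_left
  have hsplit' := hnd.of_append_right
  have h₁ := hm {(9 * m + 4, us.take m)} ⟨us.take m, hsplit⟩ c (by simp)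
    (by simp only [Multiset.mem_singleton, forall_eq, List.length_take]; omega)
    (hcells _ _).symm
  have h₂ := hn {(9 * n + 4, us.drop m)} ⟨us.drop m, hsplit'⟩ c (by simp)
    (by simp only [Multiset.mem_singleton, forall_eq, List.length_drop]; omega)
    (hcells _ _).symm
  simp only [hpay] at h₁ h₂ ⊢
  have hd : Disjoint (⟨us.take m, hsplit⟩ : Finset V) ⟨us.drop m, hsplit'⟩ := by
    rw [Finset.disjoint_left]
    exact fun x hx hx' => List.disjoint_of_nodup_append hnd hx hx'
  have := h₁.and h₂ subset_rfl subset_rfl hd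
    (fun c d h hc => by
      rwa [← payoff_congr s 0 0 fun u hu => h u (Finset.disjoint_left.1 hd hu)])
    (fun c d h hc => by
      rwa [← payoff_congr s 0 0 fun u hu => h u (Finset.disjoint_right.1 hd hu)])
  obtain rfl : F = ⟨us.take m, hsplit⟩ ∪ ⟨us.drop m, hsplit'⟩ := by
    ext x
    rw [← Finset.mem_val, hF, Finset.mem_union]
    exact List.mem_append
  refine this.mono fun c' _ h => ?_
  have := payoff_append_ge c' hs (l := 0) (by simp) (us.take m) (us.drop m)
  rw [List.take_append_drop] at this
  linarith [h.1, h.2]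

end Segments

/-! ### Certified strategies -/

/-- The list of segments with the base `256` code `k`, the first argument bounding its length. -/
noncomputable def decodeSegs (f : ℕ) : ℕ → List ℕ :=
  Nat.rec (fun _ => [])
    (fun _ ih k => bif Nat.beq k 0 then [] else (k % 256) :: ih (k / 256)) f

/-- The code of a list of segments. -/
noncomputable def encodeSegs (g : List ℕ) : ℕ :=
  List.rec 0 (fun n _ ih => ih * 256 + n) g

/-- Boolean equality of lists of numbers. -/
def eqSegs : List ℕ → List ℕ → Bool
  | [], [] => true
  | a :: g, b :: h => Nat.beq a b && eqSegs g h
  | _, _ => false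

theorem eq_of_eqSegs {g h : List ℕ} (H : eqSegs g h = true) : g = h := by
  induction g generalizing h with
  | nil => cases h <;> simp_all [eqSegs]
  | cons a g ih =>
    cases h with
    | nil => simp [eqSegs] at H
    | cons b h =>
      simp only [eqSegs, Bool.and_eq_true, Nat.beq_eq] at H
      rw [H.1, ih H.2]

/-- A search tree whose nodes hold the code of a list of segments, a promised payoff increased by
`33`, and the replies, as base `16` digits, to all moves of the opponent, the last move first. -/
inductive StrategyTable
  | leaf
  | node (left : StrategyTable) (key value replies : ℕ) (right : StrategyTable)

namespace StrategyTable

/-- The successor of the value stored at `x`, and `0` if there is none. -/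
noncomputable def find (x : ℕ) (T : StrategyTable) : ℕ :=
  StrategyTable.rec 0 (fun _ k m _ _ l r =>
    bif Nat.blt x k then l else bif Nat.blt k x then r else m + 1) T

theorem find_leaf (x : ℕ) : find x leaf = 0 := rfl

theorem find_node (x k m q : ℕ) (l r : StrategyTable) : find x (node l k m q r) =
    bif Nat.blt x k then find x l else bif Nat.blt k x then find x r else m + 1 :=
  rfl

/-- The table has a node with the given entries. -/
def Mem (x y z : ℕ) : StrategyTable → Prop
  | leaf => False
  | node l k m q r => (x = k ∧ y = m ∧ z = q) ∨ Mem x y z l ∨ Mem x y z r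

theorem exists_mem_of_find {x y : ℕ} {T : StrategyTable} (h : T.find x = y + 1) :
    ∃ z, T.Mem x y z := by
  induction T with
  | leaf => simp [find_leaf] at h
  | node l k m q r ihl ihr =>
    rw [find_node] at h
    cases hxk : Nat.blt x k with
    | true =>
      rw [hxk, cond_true] at h
      exact (ihl h).imp fun z hz => .inr (.inl hz)
    | false =>
      rw [hxk, cond_false] at h
      cases hkx : Nat.blt k x with
      | true =>
        rw [hkx, cond_true] at h
        exact (ihr h).imp fun z hz => .inr (.inr hz)
      | false =>
        rw [hkx, cond_false] at h
        have h₁ := mt Nat.blt_eq.mpr (Bool.eq_false_iff.1 hxk)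
        have h₂ := mt Nat.blt_eq.mpr (Bool.eq_false_iff.1 hkx)
        exact ⟨q, .inl ⟨by omega, by omega, rfl⟩⟩

/-- The payoff still required once the empty segments of the list are settled; the `n`-th decimal
digit of `e` is the payoff of the empty segment `n`, increased by `1`. -/
noncomputable def required (e : ℕ) (g : List ℕ) : ℕ → ℕ :=
  List.rec id (fun n _ ih m => ih (bif Nat.blt n 9 then m + 1 - e / 10 ^ n % 10 else m)) g

theorem required_cons (e n : ℕ) (g : List ℕ) (m : ℕ) : required e (n :: g) m =
    required e g (bif Nat.blt n 9 then m + 1 - e / 10 ^ n % 10 else m) :=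
  rfl

/-- The table promises the payoff `m` for the list of nonempty segments. -/
noncomputable def promises (T : StrategyTable) (m : ℕ) : List ℕ → Bool
  | [] => Nat.ble m 33
  | n :: g => evalArg (encodeSegs (n :: g)) (fun k => Nat.blt m (T.find k)) &&
      eqSegs (decodeSegs 16 (encodeSegs (n :: g))) (n :: g)

/-- After the move `p` and the reply `j`, the table promises the payoff `m`. -/
noncomputable def checkReply (T : StrategyTable) (e : ℕ) (g : List ℕ) (m p j : ℕ) : Bool :=
  Nat.blt j (segSize (playSegs 0 g p)) &&
    T.promises (required e (playSegs 2 (playSegs 0 g p) j) m)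
      (canonSegs (playSegs 2 (playSegs 0 g p) j))

/-- The replies `q` to the first moves of the opponent secure the payoff `m`. -/
noncomputable def checkReplies (T : StrategyTable) (e : ℕ) (g : List ℕ) (m : ℕ) : ℕ → ℕ → Bool
  | 0, _ => true
  | p + 1, q => evalArg (q % 16) (T.checkReply e g m p) && checkReplies T e g m p (q / 16)

/-- All entries of a table keep their promises, provided those of `T` do. -/
noncomputable def check (T : StrategyTable) (e : ℕ) : StrategyTable → Bool
  | leaf => true
  | node l k m q r => (Nat.blt 0 (segSize (decodeSegs 16 k)) &&
      T.checkReplies e (decodeSegs 16 k) m (segSize (decodeSegs 16 k)) q) &&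
      (check T e l && check T e r)

end StrategyTable

theorem segSize_insertSeg (n : ℕ) (g : List ℕ) : segSize (insertSeg n g) = n / 9 + segSize g := by
  induction g with
  | nil => rfl
  | cons a g ih =>
    rw [insertSeg_cons]
    cases Nat.ble n a with
    | true => rfl
    | false => rw [cond_false, segSize_cons, ih, segSize_cons]; omega

theorem flipSeg_div (n : ℕ) : flipSeg n / 9 = n / 9 := by
  rw [flipSeg]
  cases Nat.ble (n / 3 % 3) (n % 3) with
  | true => rfl
  | false => rw [cond_false]; omega

theorem segSize_canonSegs (g : List ℕ) : segSize (canonSegs g) = segSize g := by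
  induction g with
  | nil => rfl
  | cons n g ih =>
    rw [canonSegs_cons, segSize_cons]
    cases hn : Nat.blt n 9 with
    | true => rw [cond_true, ih, Nat.div_eq_of_lt (Nat.blt_eq.mp hn), zero_add]
    | false => rw [cond_false, segSize_insertSeg, ih, flipSeg_div]

theorem segSize_playSegs {x : ℕ} (hx : x < 3) {g : List ℕ} {p : ℕ} (hp : p < segSize g) :
    segSize (playSegs x g p) + 1 = segSize g := by
  induction g generalizing p with
  | nil => simp [segSize] at hp
  | cons n g ih =>
    rw [segSize_cons] at hp
    rw [playSegs_cons]
    cases hn : Nat.blt p (n / 9) with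
    | true =>
      have := Nat.blt_eq.mp hn
      simp only [cond_true, segSize_cons]
      omega
    | false =>
      have := mt Nat.blt_eq.mpr (Bool.eq_false_iff.1 hn)
      have := ih (p := p - n / 9) (by omega)
      simp only [cond_false, segSize_cons]
      omega

namespace StrategyTable

/-- The decimal digits of `e` describe the payoffs of the empty segments. -/
def IsPayoffCode (s : ℤ) (e : ℕ) : Prop :=
  ∀ n < 9, ((e / 10 ^ n % 10 : ℕ) : ℤ) = s * leftSign n * rightSign n + 1

theorem le_required {s : ℤ} {e : ℕ} (he : IsPayoffCode s e) (g : List ℕ) (m : ℕ) :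
    (m : ℤ) - closedPayoff s g ≤ required e g m := by
  induction g generalizing m with
  | nil => simp [required, closedPayoff]
  | cons n g ih =>
    rw [required_cons, closedPayoff]
    refine le_trans ?_ (ih _)
    by_cases hn : n < 9
    · rw [if_pos hn, Nat.blt_eq.mpr hn, cond_true]
      have := he n hn
      omega
    · rw [if_neg hn, Bool.eq_false_iff.2 (mt Nat.blt_eq.mp hn), cond_false]
      linarith

variable {V : Type*} [DecidableEq V] {s : ℤ} {e : ℕ} {T : StrategyTable}

theorem exists_reply_of_checkReplies {g : List ℕ} {m N q : ℕ}
    (h : T.checkReplies e g m N q = true) {p : ℕ} (hp : p < N) :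
    ∃ j, T.checkReply e g m p j = true := by
  induction N generalizing q with
  | zero => omega
  | succ N ih =>
    rw [checkReplies, evalArg_eq, Bool.and_eq_true] at h
    rcases Nat.lt_succ_iff_lt_or_eq.1 hp with hp | rfl
    · exact ih h.2 hp
    · exact ⟨_, h.1⟩

theorem check_of_mem {T' : StrategyTable} (hT : T.check e T' = true) {k m q : ℕ}
    (h : T'.Mem k m q) : 0 < segSize (decodeSegs 16 k) ∧
      T.checkReplies e (decodeSegs 16 k) m (segSize (decodeSegs 16 k)) q = true := by
  induction T' with
  | leaf => exact h.elim
  | node l k' m' q' r ihl ihr =>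
    simp only [check, Bool.and_eq_true] at hT
    rcases h with ⟨rfl, rfl, rfl⟩ | h | h
    · exact ⟨Nat.blt_eq.mp hT.1.1, hT.1.2⟩
    · exact ihl hT.2.1 h
    · exact ihr hT.2.2 h

theorem attains_of_mem (he : IsPayoffCode s e) (hT : T.check e T = true) {k m q : ℕ}
    (h : T.Mem k m q) : Attains V s (decodeSegs 16 k) ((m : ℤ) - 33) := by
  induction hN : segSize (decodeSegs 16 k) using Nat.strong_induction_on generalizing k m q with
  | _ N ih =>
    obtain ⟨hpos, hrep⟩ := check_of_mem hT h
    refine .of_forall_exists hpos fun p hp => ?_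
    obtain ⟨j, hj⟩ := exists_reply_of_checkReplies hrep hp
    rw [checkReply, Bool.and_eq_true] at hj
    obtain ⟨hj, hprom⟩ := hj
    have hj := Nat.blt_eq.mp hj
    refine ⟨j, hj, ?_⟩
    have hsize := segSize_playSegs (x := 0) (by omega) hp
    have hsize' := segSize_playSegs (x := 2) (by omega) hj
    set g := playSegs 2 (playSegs 0 (decodeSegs 16 k) p) j
    have hreq := le_required he g m
    rw [← segSize_canonSegs] at hsize'
    refine (Attains.of_canonSegs (t := required e g m - 33) ?_).mono (by linarith)
    cases hc : canonSegs g with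
    | nil =>
      rw [hc, promises] at hprom
      have := Nat.ble_eq.mp hprom
      exact Attains.zero.mono (by omega)
    | cons n g' =>
      rw [hc, promises, evalArg_eq, Bool.and_eq_true] at hprom
      have hlt := Nat.blt_eq.mp hprom.1
      have hdec := eq_of_eqSegs hprom.2
      obtain ⟨y, hy⟩ := Nat.exists_eq_succ_of_ne_zero (Nat.ne_zero_of_lt hlt)
      obtain ⟨z, hz⟩ := exists_mem_of_find hy
      have := ih _ (by rw [hdec, ← hc]; omega) hz rfl
      rw [hdec] at this
      exact this.mono (by omega)

theorem attains_of_find (he : IsPayoffCode s e) (hT : T.check e T = true) {n m : ℕ}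
    (h : T.find n = m + 1) (hn : decodeSegs 16 n = [n]) : Attains V s {n} ((m : ℤ) - 33) := by
  obtain ⟨q, hq⟩ := exists_mem_of_find h
  simpa [hn] using attains_of_mem (V := V) he hT hq

end StrategyTable

/-- A strategy for collecting edges between different classes. -/
def lowerTable : StrategyTable :=
  .node (.node (.node (.node (.node (.node (.node (.node (.node (.node .leaf 20 28 0 .leaf) 22 34 0
  .leaf) 23 33 0 (.node .leaf 26 34 0 .leaf)) 44 32 257 (.node (.node (.node .leaf 62 34 135713
  .leaf) 91 31 73888309524 .leaf) 95 33 73300709649 (.node .leaf 109 33 352420097 .leaf))) 110 34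
  18691967160321 (.node (.node (.node (.node .leaf 113 35 18771227343249 .leaf) 116 36
  18774449617297 .leaf) 127 35 35205972795392 (.node .leaf 128 36 3300153887488 .leaf)) 148 36
  16150546356198100192 (.node (.node (.node .leaf 2825 27 0 .leaf) 2827 33 0 .leaf) 3593 28 0 (.node
  .leaf 3595 30 0 .leaf)))) 3598 33 0 (.node (.node (.node (.node (.node .leaf 4361 29 0 .leaf) 4363
  31 0 .leaf) 4366 32 0 (.node .leaf 4369 33 0 .leaf)) 5140 31 4096 (.node (.node (.node .leaf 6676
  33 0 .leaf) 6679 34 34 .leaf) 6682 35 34 (.node .leaf 7433 29 1 .leaf))) 7441 33 273 (.node (.node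
  (.node (.node .leaf 9236 31 2170882 .leaf) 9748 33 2228258 .leaf) 9751 30 2228259 (.node .leaf
  9754 35 2236962 .leaf)) 9766 35 17476 (.node (.node (.node .leaf 10516 32 2228770 .leaf) 10522 34
  2236962 .leaf) 10532 30 16801812 (.node .leaf 10534 34 17476 .leaf))))) 11287 32 800 (.node (.node
  (.node (.node (.node (.node .leaf 11302 33 285286674 .leaf) 11305 34 286332241 .leaf) 11308 35
  286332241 (.node .leaf 12043 33 139538 .leaf)) 12078 32 77377568768 (.node (.node (.node .leaf
  12814 33 139810 .leaf) 12845 32 73015496807 .leaf) 12847 34 438087738994 (.node .leaf 12850 33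
  283469967959 .leaf))) 13577 33 2236466 (.node (.node (.node (.node .leaf 13844 33 304226914 .leaf)
  13850 33 287515170 .leaf) 13865 34 4539460 (.node .leaf 13868 33 4617556 .leaf)) 14374 33
  81622360612 (.node (.node (.node .leaf 14377 34 73304130626 .leaf) 14380 35 73304131396 .leaf)
  14392 35 12891611233 (.node .leaf 15124 32 554713858 .leaf)))) 15130 34 574764098 (.node (.node
  (.node (.node (.node .leaf 15142 34 1136146 .leaf) 15892 33 1048577 .leaf) 15898 35 4338754 (.node
  .leaf 15910 35 1332865 .leaf)) 15913 34 2381698 (.node (.node (.node .leaf 15926 35 1112397609217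
  .leaf) 16178 34 75050885010853 .leaf) 16401 32 572609042 (.node .leaf 16431 34 79165195126096
  .leaf))) 16434 33 81364487874208 (.node (.node (.node (.node .leaf 16654 32 37822994 .leaf) 16657
  33 35721490 .leaf) 17417 30 22094613 (.node .leaf 17419 32 34677265 .leaf)) 17425 34 35796306
  (.node (.node (.node .leaf 17435 32 20971783 .leaf) 17437 34 16797812 .leaf) 17453 34 12884930711
  (.node .leaf 17454 33 18704586899717 .leaf)))))) 17458 35 70514778470805 (.node (.node (.node
  (.node (.node (.node (.node .leaf 17472 35 3321728372919 .leaf) 18185 31 16789507 .leaf) 18186 32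
  33562626 (.node .leaf 18187 33 33562625 .leaf)) 18190 34 35796306 (.node (.node (.node .leaf 18193
  35 35796306 .leaf) 18205 35 16777217 .leaf) 18455 32 146903806771 (.node .leaf 18473 34
  21106614813860 .leaf))) 18476 35 18765857638820 (.node (.node (.node (.node .leaf 18708 32
  73067078195 .leaf) 18729 33 52845902906788 .leaf) 18964 33 73067004419 (.node .leaf 18967 34
  74727957027 .leaf)) 18981 34 3300821058625 (.node (.node (.node .leaf 18982 35 52777703457860
  .leaf) 18985 34 52777709749412 .leaf) 19732 32 73014444064 (.node .leaf 19753 35 53950230722962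
  .leaf)))) 20753 33 280268710449 (.node (.node (.node (.node (.node .leaf 21003 32 74676592914
  .leaf) 21009 34 73351106833 .leaf) 21021 34 15119647537 (.node .leaf 21042 35 54115786239092160
  .leaf)) 21258 32 74914603026 (.node (.node (.node .leaf 21259 33 74106150930 .leaf) 21262 34
  73300775185 .leaf) 21265 35 73300775185 (.node .leaf 21277 35 14015478065 .leaf))) 22027 34
  74661975602 (.node (.node (.node (.node .leaf 22793 33 74146910806 .leaf) 22794 34 74661783346
  .leaf) 22795 35 73588037234 (.node .leaf 22811 35 73431040 .leaf)) 23063 34 18838299550290 (.node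
  (.node (.node .leaf 23316 34 17601398997536 .leaf) 23319 33 17605714973600 .leaf) 23337 35
  54061080967947460 (.node .leaf 23571 34 18705155236387 .leaf))))) 24338 34 67530896 (.node (.node
  (.node (.node (.node (.node .leaf 24339 33 4598145281 .leaf) 24343 35 17602996238736 .leaf) 24357
  35 38707688676017 (.node .leaf 25361 35 18765804149153 .leaf)) 25866 34 18764998447377 (.node
  (.node (.node .leaf 25867 35 18764998447377 .leaf) 27927 35 54080738500453056 .leaf) 28947 35
  19808497736194 (.node .leaf 1182475 32 4386 .leaf))) 1184009 30 4352 (.node (.node (.node (.node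
  .leaf 1184011 28 4352 .leaf) 1184014 33 4386 .leaf) 1184017 30 4386 (.node .leaf 1249553 31 4386
  .leaf)) 1313546 29 4096 (.node (.node (.node .leaf 1313547 32 4354 .leaf) 1314313 31 4096 .leaf)
  1314315 31 4370 (.node .leaf 1314318 32 4386 .leaf)))) 1315081 32 4096 (.node (.node (.node (.node
  (.node .leaf 1315086 31 4386 .leaf) 1315089 32 4386 .leaf) 1315858 32 770 (.node .leaf 1510155 33
  2 .leaf)) 1510923 32 18 (.node (.node (.node .leaf 1511691 31 2 .leaf) 1511697 33 34 .leaf)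
  1706761 32 0 (.node .leaf 1706762 33 0 .leaf))) 1706763 34 0 (.node (.node (.node (.node .leaf
  1707529 31 0 .leaf) 1707530 32 0 .leaf) 1707531 33 17 (.node .leaf 1707534 34 34 .leaf)) 1708299
  32 0 (.node (.node (.node .leaf 1708302 33 34 .leaf) 1708305 34 34 .leaf) 1709074 34 0 (.node
  .leaf 1709075 33 0 .leaf))))))) 1709076 32 273 (.node (.node (.node (.node (.node (.node (.node
  (.node .leaf 1709842 35 0 .leaf) 1709843 34 0 .leaf) 1709844 33 256 (.node .leaf 1710610 36 0
  .leaf)) 1710611 35 0 (.node (.node (.node .leaf 1710612 34 0 .leaf) 1710615 35 8772 .leaf) 1774603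
  32 2241299 (.node .leaf 1776139 32 2237235 .leaf))) 1840142 32 3289921 (.node (.node (.node (.node
  .leaf 1841678 34 2237235 .leaf) 1905169 30 3216177 .leaf) 1905674 31 131123 (.node .leaf 1905681
  32 69953 .leaf)) 1906449 33 70450 (.node (.node (.node .leaf 1907209 34 2236419 .leaf) 1907214 33
  140081 .leaf) 1907217 34 70451 (.node .leaf 1907482 32 1145061970 .leaf)))) 1907732 31 574620451
  (.node (.node (.node (.node (.node .leaf 1907988 32 553713680 .leaf) 1907991 33 572801570 .leaf)
  1907994 34 572736098 (.node .leaf 2102283 29 2236419 .leaf)) 2103817 33 2236419 (.node (.node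
  (.node .leaf 2103818 34 2236419 .leaf) 2103825 33 2237235 .leaf) 2362123 32 2236962 (.node .leaf
  2362890 30 2241315 .leaf))) 2362894 32 2237218 (.node (.node (.node (.node .leaf 2366478 32
  554967314 .leaf) 2366737 32 591610980 .leaf) 2427659 29 2237250 (.node .leaf 2429195 31 2237219
  .leaf)) 2429201 33 2236962 (.node (.node (.node .leaf 2431508 33 1124090900 .leaf) 2431514 35
  1145324612 .leaf) 2432273 33 286344484 (.node .leaf 2432285 33 10200965216 .leaf))))) 2493193 32
  2237187 (.node (.node (.node (.node (.node (.node .leaf 2493195 34 2236962 .leaf) 2493962 32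
  2236451 .leaf) 2493963 33 2236962 (.node .leaf 2493966 34 2236962 .leaf)) 2494730 31 2228259
  (.node (.node (.node .leaf 2494731 32 2228259 .leaf) 2494734 33 2236962 .leaf) 2494737 34 2236962
  (.node .leaf 2495506 34 17408 .leaf))) 2495507 31 82433 (.node (.node (.node (.node .leaf 2495508
  32 65553 .leaf) 2496276 33 1073741829 .leaf) 2496279 32 268435461 (.node .leaf 2497042 34 17408
  .leaf)) 2497043 35 17412 (.node (.node (.node .leaf 2497044 34 1028 .leaf) 2497047 35 4473924
  .leaf) 2497550 34 286344258 (.node .leaf 2497553 33 17895698 .leaf)))) 2497801 34 70933 (.node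
  (.node (.node (.node (.node .leaf 2497806 33 17895698 .leaf) 2497809 34 17896468 .leaf) 2497821 34
  4836034144 (.node .leaf 2498574 32 1118485 .leaf)) 2499860 33 146064670819 (.node (.node (.node
  .leaf 2499866 35 146601567846 .leaf) 2500115 33 33687046 .leaf) 2500116 34 131076 (.node .leaf
  2689801 31 2236451 .leaf))) 2689803 33 2236962 (.node (.node (.node (.node .leaf 2691337 31
  2228786 .leaf) 2691339 33 2229043 .leaf) 2691345 33 2236962 (.node .leaf 2692114 33 17412 .leaf))
  2692116 33 268435461 (.node (.node (.node .leaf 2692884 32 285344259 .leaf) 2693650 35 17492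
  .leaf) 2693655 34 1089 (.node .leaf 2693899 33 17908756 .leaf)))))) 2693905 33 17895701 (.node
  (.node (.node (.node (.node (.node (.node .leaf 2694161 32 572592658 .leaf) 2694409 33 69701
  .leaf) 2694411 33 17899797 (.node .leaf 2694417 33 17896516 .leaf)) 2694427 33 3145728 (.node
  (.node (.node .leaf 2694428 32 73014575122 .leaf) 2694429 33 53479014 .leaf) 2695179 32 1122578
  (.node .leaf 2695185 34 17896786 .leaf))) 2695197 34 53686388 (.node (.node (.node (.node .leaf
  2696215 32 68771906097 .leaf) 2696722 35 570451574 .leaf) 2696724 33 33556064 (.node .leaf 2696727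
  34 570426976 .leaf)) 2696741 34 8933620136088 (.node (.node (.node .leaf 2885897 32 816 .leaf)
  2886410 31 8195 .leaf) 2886411 32 8194 (.node .leaf 2887179 33 2106163 .leaf)))) 2887945 32
  2097728 (.node (.node (.node (.node (.node .leaf 2887946 33 2097968 .leaf) 2887947 34 2097968
  .leaf) 2887950 33 2097968 (.node .leaf 2889495 34 268436816 .leaf)) 2890506 31 285282305 (.node
  (.node (.node .leaf 2890513 34 286331153 .leaf) 2891019 34 286335250 .leaf) 2891022 33 286332241
  (.node .leaf 2891035 34 12935300976 .leaf))) 2891790 34 286332241 (.node (.node (.node (.node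
  .leaf 2955019 31 574898996 .leaf) 2955025 33 572736307 .leaf) 2956567 33 365645096277 (.node .leaf
  2958865 34 293204223317 .leaf)) 2959627 33 160023532933 (.node (.node (.node .leaf 2960395 34
  297499190613 .leaf) 3019787 31 572604720 .leaf) 3019793 33 572605235 (.node .leaf 3020561 32
  1650549571 .leaf))))) 3022100 33 292093449552 (.node (.node (.node (.node (.node (.node .leaf
  3025163 32 154989193349 .leaf) 3025169 34 154922211461 .leaf) 3025181 34 26645854119 (.node .leaf
  3085067 33 286331170 .leaf)) 3085073 33 304157460 (.node (.node (.node .leaf 3085323 32 269492224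
  .leaf) 3085326 33 306254612 .leaf) 3085329 34 304165683 (.node .leaf 3086091 33 538198836 .leaf)))
  3086097 33 572601139 (.node (.node (.node (.node .leaf 3086858 33 1073741828 .leaf) 3086859 34
  1073741876 .leaf) 3087127 33 86505563430 (.node .leaf 3087635 33 103081321814 .leaf)) 3088404 33
  94522991190 (.node (.node (.node .leaf 3088407 34 73048139094 .leaf) 3089675 33 73384731990 .leaf)
  3089696 34 35198468097912 (.node .leaf 3089930 33 73656172630 .leaf)))) 3089931 34 73351037011
  (.node (.node (.node (.node (.node .leaf 3090702 34 154922001750 .leaf) 3281419 31 1145127217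
  .leaf) 3281681 32 35725842 (.node .leaf 3281929 31 1142948165 .leaf)) 3281931 33 1145049425 (.node
  (.node (.node .leaf 3282699 32 304156961 .leaf) 3282705 34 304166225 .leaf) 3283732 33 73587106419
  (.node .leaf 3284242 33 438120349815 .leaf))) 3284247 34 284040385136 (.node (.node (.node (.node
  .leaf 3286283 32 74676580947 .leaf) 3286289 34 73304135282 .leaf) 3286301 34 15122593940 (.node
  .leaf 3287305 32 163578925685 .leaf)) 3287307 34 154921883251 (.node (.node .leaf 3287323 34
  26578284689 .leaf) 3288343 34 105704012673683 (.node .leaf 3288851 34 584689217681 .leaf))))))))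
  3289618 34 695852232848 (.node (.node (.node (.node (.node (.node (.node (.node (.node .leaf
  3478025 34 1073811473 .leaf) 3478537 32 1090527520 .leaf) 3478539 34 1140855056 (.node .leaf
  3480340 34 73587097602 .leaf)) 3541771 34 287449634 (.node (.node (.node .leaf 3542538 32
  589440354 .leaf) 3542542 34 572662370 .leaf) 3543307 32 556028722 (.node .leaf 3544852 33
  223372199744 .leaf))) 3544855 32 77326546240 (.node (.node (.node (.node .leaf 3546126 34
  142073939076 .leaf) 3546385 34 13174589316 .leaf) 3549463 34 9955600806 (.node .leaf 3672842 31
  570441732 .leaf)) 3672843 32 570441730 (.node (.node (.node .leaf 3673611 33 572662306 .leaf)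
  3674378 33 572662306 .leaf) 3674379 34 572662306 (.node .leaf 3674382 33 572662306 .leaf))))
  3675155 33 81705321540 (.node (.node (.node (.node (.node .leaf 3675922 33 438086664256 .leaf)
  3675927 34 73018917952 .leaf) 3676945 34 74106093845 (.node .leaf 3677450 33 73300722757 .leaf))
  3677451 34 73300723525 (.node (.node (.node .leaf 3678222 34 73304131396 .leaf) 3679511 34
  74939665573475 .leaf) 3680531 34 77343188577 (.node .leaf 3869451 33 570569794 .leaf))) 3870219 32
  1645223970 (.node (.node (.node (.node .leaf 3870986 32 606085634 .leaf) 3870990 34 639776082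
  .leaf) 3871763 32 117511169 (.node .leaf 3873809 34 73384857873 .leaf)) 3874062 34 4584462194
  (.node (.node (.node .leaf 3874827 34 13171250706 .leaf) 3876116 34 27498614519845 .leaf) 3876371
  34 8624932870 (.node .leaf 4066059 34 13312 .leaf))))) 4066826 32 6312706 (.node (.node (.node
  (.node (.node (.node .leaf 4066827 33 1062145 .leaf) 4066830 34 4338754 .leaf) 4070155 34
  5386622737 (.node .leaf 4070414 34 73302038402 .leaf)) 4070665 34 1132724356 (.node (.node (.node
  .leaf 4134667 33 215339053875 .leaf) 4199435 33 10254246704 .leaf) 4200203 32 10792346753 (.node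
  .leaf 4200209 34 34681860995 .leaf))) 4201751 34 187063637214624 (.node (.node (.node (.node .leaf
  4204811 34 46257155704224 .leaf) 4264715 33 26861450002 .leaf) 4264970 33 27666690864 (.node .leaf
  4264971 34 9683603760 .leaf)) 4264974 33 8878306096 (.node (.node (.node .leaf 4269326 34
  40136755991894 .leaf) 4461067 33 4586557812 .leaf) 4461323 32 73302946099 (.node .leaf 4461329 34
  73302872339 .leaf)))) 4462345 32 370356533 (.node (.node (.node (.node (.node .leaf 4462347 34
  8878511667 .leaf) 4463383 34 70515315339925 .leaf) 4463891 34 146319372293 (.node .leaf 4465931 34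
  18774448566675 .leaf)) 4657929 33 100683781 (.node (.node (.node .leaf 4722955 34 77884170882
  .leaf) 4724503 34 17601921501604 .leaf) 4787723 32 142363198210 (.node .leaf 4852490 33
  74665042434 .leaf))) 4852491 34 73589203458 (.node (.node (.node (.node .leaf 4853259 33
  73593397778 .leaf) 4853262 34 73654215203 .leaf) 4855571 34 6581142593 (.node .leaf 5049867 34
  73588037234 .leaf)) 5050634 34 73014444144 (.node (.node (.node .leaf 5051411 34 17605138450433
  .leaf) 5379851 34 11077616370593 .leaf) 5444366 34 1174727242548 (.node .leaf 5967371 34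
  36430485258786 .leaf)))))) 185273097 31 0 (.node (.node (.node (.node (.node (.node (.node .leaf
  185273099 33 0 .leaf) 235604489 29 17 .leaf) 235604745 30 8192 (.node .leaf 235604746 31 8192
  .leaf)) 235604747 32 8736 (.node (.node (.node .leaf 235801353 31 0 .leaf) 235801355 33 34 .leaf)
  285935881 31 0 (.node .leaf 285936394 30 0 .leaf))) 285936395 31 0 (.node (.node (.node (.node
  .leaf 286132489 32 0 .leaf) 286133001 30 0 .leaf) 286133003 32 0 (.node .leaf 286133771 31 0
  .leaf)) 286329097 33 0 (.node (.node (.node .leaf 286329610 32 0 .leaf) 286329611 33 0 .leaf)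
  286330378 31 0 (.node .leaf 286330379 32 0 .leaf)))) 286330382 33 0 (.node (.node (.node (.node
  (.node .leaf 319951115 30 3420960 .leaf) 336726795 33 1122850 .leaf) 336727563 32 1122850 (.node
  .leaf 336727566 33 1122850 .leaf)) 336728330 30 3211296 (.node (.node (.node .leaf 336792331 32
  1122850 .leaf) 336793865 30 1122338 .leaf) 336793867 32 1126434 (.node .leaf 336857866 30 516
  .leaf))) 336857867 31 515 (.node (.node (.node (.node .leaf 336858635 32 1060896 .leaf) 336858638
  31 8224 .leaf) 336859401 31 1056832 (.node .leaf 336859402 32 1060896 .leaf)) 336859403 33 1060896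
  (.node (.node (.node .leaf 336859406 32 1060896 .leaf) 336860179 32 285409794 .leaf) 387058443 34
  1122852 (.node .leaf 387059209 31 1258274 .leaf))))) 387059979 32 1122850 (.node (.node (.node
  (.node (.node (.node .leaf 387125515 31 2171427 .leaf) 387125521 33 2236962 .leaf) 387189513 30
  1245952 (.node .leaf 387189515 32 1114626 .leaf)) 387191049 32 1246020 (.node (.node (.node .leaf
  387191051 32 1126946 .leaf) 387191827 31 1360072961 .leaf) 387386123 31 1114626 (.node .leaf
  387387659 33 1126946 .leaf))) 387388436 33 318964996 (.node (.node (.node (.node .leaf 437390089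
  33 1114112 .leaf) 437390090 34 1122816 .leaf) 437390091 33 1122816 (.node .leaf 437390859 34
  1122850 .leaf)) 437391627 33 1122850 (.node (.node (.node .leaf 437391633 33 1122850 .leaf)
  437455625 30 1114146 .leaf) 437455627 32 1114146 (.node .leaf 437521162 32 0 .leaf)))) 437521163
  33 0 (.node (.node (.node (.node (.node .leaf 437521929 32 1048576 .leaf) 437521934 33 8738 .leaf)
  437523474 33 131840 (.node .leaf 437717769 32 0 .leaf)) 437717771 34 0 (.node (.node (.node .leaf
  437719826 35 2237235 .leaf) 437720083 33 1118481 .leaf) 437914378 34 0 (.node .leaf 437914379 35 0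
  .leaf))) 437915150 35 8772 (.node (.node (.node (.node .leaf 437917459 35 1118481 .leaf) 453708555
  33 2237235 .leaf) 453905162 31 2302771 (.node .leaf 453905931 33 2237235 .leaf)) 454102539 32
  2301952 (.node (.node .leaf 454103310 32 2237187 .leaf) 454300689 33 340018517 (.node .leaf
  454497291 32 1413493073 .leaf))))))) 470682379 33 2237235 (.node (.node (.node (.node (.node
  (.node (.node (.node .leaf 470879755 31 3285824 .leaf) 470880526 33 2306867 .leaf) 471077390 33
  1360086321 (.node .leaf 471274513 33 878989669 .leaf)) 471535115 33 371467602 (.node (.node (.node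
  .leaf 487262985 33 2236416 .leaf) 487459593 32 2236419 .leaf) 487459595 32 2237234 (.node .leaf
  487655689 33 0 .leaf))) 487655945 30 4369 (.node (.node (.node (.node .leaf 487656202 32 9011
  .leaf) 487656203 33 9011 .leaf) 487656969 32 2105344 (.node .leaf 487656971 32 9008 .leaf))
  487656974 33 9008 (.node (.node (.node .leaf 487854859 32 1110511889 .leaf) 487855114 32 34672912
  .leaf) 487855118 32 35721552 (.node .leaf 488051211 32 1145323793 .leaf)))) 488051473 33
  1091642706 (.node (.node (.node (.node (.node .leaf 488051721 32 69337349 .leaf) 488051722 31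
  35717891 .leaf) 488052489 31 52564258 (.node .leaf 488052491 33 35722577 .leaf)) 488247817 33
  1073811457 (.node (.node (.node .leaf 488248073 34 1090588690 .leaf) 488249097 34 1091846144
  .leaf) 488313099 33 337650211 (.node .leaf 488314647 33 81659184197 .leaf))) 488378638 33
  337847637 (.node (.node (.node (.node .leaf 488442634 32 572539394 .leaf) 488442635 33 572539394
  .leaf) 488443403 32 304096514 (.node .leaf 488443406 33 287597092 .leaf)) 488445715 33 21042193
  (.node (.node (.node .leaf 537791243 31 2236419 .leaf) 537988619 33 2237235 .leaf) 537989386 33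
  2306048 (.node .leaf 538186763 32 1142174033 .leaf))))) 538383371 33 1145323793 (.node (.node
  (.node (.node (.node (.node .leaf 538579466 35 1091846149 .leaf) 538579473 34 1091847509 .leaf)
  538579977 32 16777216 (.node .leaf 538579978 33 17055744 .leaf)) 538644750 33 1378099749 (.node
  (.node (.node .leaf 538775049 31 558129749 .leaf) 538775051 33 622994725 .leaf) 605294859 33
  808731972 (.node .leaf 622006539 31 572662626 .leaf))) 622070539 32 289555040 (.node (.node (.node
  (.node .leaf 622071307 31 1362495073 .leaf) 622072073 32 335953924 .leaf) 622072078 33 355804482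
  (.node .leaf 622268683 33 291652644 .leaf)) 622269460 33 81660478980 (.node (.node (.node .leaf
  622463753 32 1124089856 .leaf) 622463755 34 1145324548 .leaf) 622662670 33 22837138278 (.node
  .leaf 622663435 33 10528121729 .leaf)))) 622664201 34 146565980288 (.node (.node (.node (.node
  (.node .leaf 622859275 33 146652882742 .leaf) 638717451 34 287458340 .leaf) 638718219 33 287449637
  (.node .leaf 638782219 32 287318563 .leaf)) 638783758 33 287449651 (.node (.node (.node .leaf
  638847754 32 8704 .leaf) 638847755 33 8704 .leaf) 638848523 32 74753 (.node .leaf 638848526 33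
  2236995 .leaf))) 638849289 33 268828740 (.node (.node (.node (.node .leaf 639044361 32 1073889284
  .leaf) 639044363 34 1140999172 .leaf) 639046675 33 285288033 (.node .leaf 639240970 34 17408
  .leaf)) 639241737 32 4 (.node (.node (.node .leaf 639241738 33 5 .leaf) 639241742 35 2245700
  .leaf) 639244051 35 538011270 (.node .leaf 639439630 33 4318172007 .leaf)))))) 639440649 34
  142002552838 (.node (.node (.node (.node (.node (.node (.node .leaf 639962635 33 77414408806
  .leaf) 689048331 34 287458388 .leaf) 689049867 34 287450453 (.node .leaf 689115401 31 572531508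
  .leaf)) 689180171 33 1078207056 (.node (.node (.node .leaf 689181715 33 50464262 .leaf) 689376009
  31 285356580 .leaf) 689376011 33 285353027 (.node .leaf 689641227 33 288429618 .leaf))) 689771275
  33 73037648150 (.node (.node (.node (.node .leaf 690293515 33 73656194678 .leaf) 690295049 33
  77311510022 .leaf) 739379979 33 287457284 (.node .leaf 739511049 33 285290499 .leaf)) 739707145 32
  2236418 (.node (.node (.node .leaf 755895051 32 572736307 .leaf) 756487947 33 17518912853 .leaf)
  772869643 33 842217011 (.node .leaf 773656075 33 155281880405 .leaf)))) 789449481 32 603979827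
  (.node (.node (.node (.node (.node .leaf 789450251 33 1091584000 .leaf) 789645833 32 575668275
  .leaf) 789844750 33 4582368598 (.node .leaf 790041355 33 73286165846 .leaf)) 790629897 33
  300683363669 (.node (.node (.node .leaf 839781131 33 2110467 .leaf) 839977738 33 572522576 .leaf)
  840176395 33 73306018161 (.node .leaf 840372747 33 4633743733 .leaf))) 840373257 33 1076887667
  (.node (.node (.node (.node .leaf 924061195 33 288654361668 .leaf) 940772875 33 142306853955
  .leaf) 991038987 33 73593528356 (.node .leaf 1074662155 33 146623628162 .leaf)) 1091439370 33
  139049579265 (.node (.node (.node .leaf 77545016075 33 3354692 .leaf) 77595347723 32 3354692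
  .leaf) 77595544073 32 4881 (.node .leaf 77595544331 33 12868 .leaf))))) 77595740938 33 3355460
  (.node (.node (.node (.node (.node (.node .leaf 81890315017 31 3355393 .leaf) 86134950665 31
  3145728 .leaf) 86135147275 32 0 (.node .leaf 86185282057 31 3215361 .leaf)) 86185282313 32 3215361
  (.node (.node (.node .leaf 86185478922 32 3158016 .leaf) 86185479689 32 3145729 .leaf) 86236139019
  32 287449891 (.node .leaf 98969520905 31 4 .leaf))) 98969520907 33 4 (.node (.node (.node (.node
  .leaf 99019852041 32 13056 .leaf) 99070184202 32 3145728 .leaf) 99120976138 32 352323136 (.node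
  .leaf 99121040139 32 572666630 .leaf)) 99171306251 32 287441926 (.node (.node (.node .leaf
  99171437321 32 319030276 .leaf) 111904753929 33 0 .leaf) 111904754442 32 0 (.node .leaf
  111904951049 32 0 .leaf)))) 111904951051 34 0 (.node (.node (.node (.node (.node .leaf
  111955282185 33 12288 .leaf) 112005876490 33 2228224 .leaf) 112005942793 32 270541619 (.node .leaf
  112056273673 32 2098227 .leaf)) 124873739019 32 857932596 (.node (.node (.node .leaf 124890516234
  32 621805568 .leaf) 124940651273 33 1145122816 .leaf) 124991180297 34 1074020357 (.node .leaf
  124991771401 34 416665444352 .leaf))) 137775418121 32 603996245 (.node (.node (.node (.node .leaf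
  137876476426 34 142056251399 .leaf) 159149394699 32 859047267 .leaf) 163646213641 34 68726169702
  (.node .leaf 176379595273 32 1114388 .leaf)) 189264496905 34 139266 (.node (.node .leaf
  15453477604105 31 0 .leaf) 28669142305545 33 858784068 (.node .leaf 31946202352393 33 1145044997
  .leaf))))))))

/-- A strategy for collecting edges inside the classes. -/
def upperTable : StrategyTable :=
  .node (.node (.node (.node (.node (.node (.node (.node (.node (.node .leaf 22 30 0 .leaf) 26 32 0
  .leaf) 40 30 4353 (.node (.node .leaf 56 30 1246209 .leaf) 58 30 1179937 .leaf)) 59 31 1115139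
  (.node (.node (.node .leaf 62 32 1114371 .leaf) 73 25 39194640 .leaf) 76 30 71389216 (.node .leaf
  92 30 433809592577 .leaf))) 94 30 103219857409 (.node (.node (.node (.node .leaf 98 28
  433830717442 .leaf) 112 30 126695750240000 .leaf) 128 30 7881372363001857 (.node .leaf 130 30
  48413816455416834 .leaf)) 148 30 16288995663968734912 (.node (.node (.node .leaf 2313 33 0 .leaf)
  2569 32 0 .leaf) 2570 33 0 (.node .leaf 2825 31 0 .leaf)))) 2826 32 0 (.node (.node (.node (.node
  (.node .leaf 2827 33 0 .leaf) 3593 30 0 .leaf) 3594 31 0 (.node (.node .leaf 3595 32 0 .leaf) 4369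
  33 0 .leaf)) 4626 27 4352 (.node (.node (.node .leaf 5140 29 8721 .leaf) 6682 31 34 .leaf) 6923 33
  4353 (.node .leaf 6926 32 4353 .leaf))) 7179 30 4353 (.node (.node (.node (.node .leaf 7435 31 513
  .leaf) 7438 30 513 .leaf) 7451 25 131073 (.node .leaf 8201 30 513 .leaf)) 8203 32 513 (.node
  (.node (.node .leaf 8206 31 513 .leaf) 8970 32 513 .leaf) 8971 33 513 (.node .leaf 8977 31 258
  .leaf))))) 8989 31 257 (.node (.node (.node (.node (.node (.node .leaf 8992 30 1027 .leaf) 9747 30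
  1245440 .leaf) 9754 31 1122339 (.node (.node .leaf 11531 31 1118481 .leaf) 11534 30 1118529
  .leaf)) 12041 29 1253634 (.node (.node (.node .leaf 12049 31 1130754 .leaf) 12060 30 1664180500
  .leaf) 12064 30 39871252 (.node .leaf 12077 31 74357743910 .leaf))) 13850 31 857756418 (.node
  (.node (.node (.node .leaf 13862 31 12906991893 .leaf) 14354 29 3146272 .leaf) 14362 29 131890
  (.node .leaf 14372 31 73032339729 .leaf)) 14373 30 73031291153 (.node (.node (.node .leaf 14374 29
  4316992325 .leaf) 14392 31 72886847362389 .leaf) 16395 30 35983635 (.node .leaf 16431 30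
  186917352810084 .leaf)))) 16650 30 3215618 (.node (.node (.node (.node (.node .leaf 16651 31
  5443843 .leaf) 16654 30 83458 .leaf) 16668 30 8606781697 (.node .leaf 16672 30 68721771552 .leaf))
  16686 30 3505028964609 (.node (.node (.node .leaf 16687 31 20891061365412 .leaf) 17419 30 2101554
  .leaf) 18744 30 54677280212563318 (.node .leaf 18964 29 365343285523 .leaf))) 18967 28
  378227790355 (.node (.node (.node (.node .leaf 21024 29 166276005135411 .leaf) 21257 31
  434346537234 .leaf) 21258 30 447232487954 (.node .leaf 23316 30 109475134051107 .leaf)) 23319 29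
  109541705886291 (.node (.node (.node .leaf 23572 31 11687043477795 .leaf) 23575 30 11725968614179
  .leaf) 25611 30 130460024283971 (.node .leaf 25865 29 4563407121 .leaf)))))) 25866 30
  175965078561091 (.node (.node (.node (.node (.node (.node (.node .leaf 25867 31 175965078565155
  .leaf) 25884 30 7882176348308325 .leaf) 26634 29 4299362577 (.node (.node .leaf 27403 29
  481308999744 .leaf) 30219 30 47440265424290593 .leaf)) 1182217 31 4352 (.node (.node (.node .leaf
  1182473 30 4352 .leaf) 1182474 31 4352 .leaf) 1182475 32 4352 (.node .leaf 1183243 31 4352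
  .leaf))) 1248009 31 4609 (.node (.node (.node (.node .leaf 1248011 31 4352 .leaf) 1248779 32 8705
  .leaf) 1313289 31 8705 (.node .leaf 1313290 30 8704 .leaf)) 1313545 32 8705 (.node (.node (.node
  .leaf 1313546 31 8705 .leaf) 1314313 29 8705 .leaf) 1315081 30 4625 (.node .leaf 1315083 32 4625
  .leaf)))) 1315858 30 1130544 (.node (.node (.node (.node (.node .leaf 1509641 29 8704 .leaf)
  1510153 31 8705 .leaf) 1510154 32 8705 (.node (.node .leaf 1512467 30 2244913 .leaf) 1512468 31
  3289345 .leaf)) 1706249 32 34 (.node (.node (.node .leaf 1706505 31 34 .leaf) 1706763 32 0 .leaf)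
  1707531 31 0 (.node .leaf 1774090 31 139537 .leaf))) 1774601 28 1061410 (.node (.node (.node
  (.node .leaf 1776142 31 3146499 .leaf) 1839627 31 3285249 .leaf) 1839883 32 3293474 (.node .leaf
  1840137 31 1192482 .leaf)) 1840139 31 1065474 (.node (.node (.node .leaf 1841946 31 1431655731
  .leaf) 1905163 30 70657 .leaf) 1905166 29 70657 (.node .leaf 1905169 28 278784 .leaf))))) 1905419
  31 1131522 (.node (.node (.node (.node (.node (.node .leaf 1905674 31 1065474 .leaf) 1905675 32
  1065218 .leaf) 1906442 30 1065987 (.node (.node .leaf 1907214 29 2098227 .leaf) 1907476 28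
  301990674 .leaf)) 1907482 30 285213491 (.node (.node (.node .leaf 1907732 31 907415841 .leaf)
  1907988 30 839913729 .leaf) 2102281 29 1057026 (.node .leaf 2102283 31 1065218 .leaf))) 2103051 32
  1065218 (.node (.node (.node (.node .leaf 2104599 30 909190244 .leaf) 2298379 32 70659 .leaf)
  2298889 32 8754 (.node .leaf 2299657 31 9267 .leaf)) 2300427 32 257 (.node (.node (.node .leaf
  2362121 30 1180448 .leaf) 2362891 29 1114384 .leaf) 2363657 30 2237218 (.node .leaf 2366734 27
  1107362608 .leaf)))) 2366749 30 353882210576 (.node (.node (.node (.node (.node .leaf 2368538 30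
  147423831906 .leaf) 2428425 30 1197072 .leaf) 2428427 30 1118480 (.node .leaf 2430740 30 573989140
  .leaf)) 2434068 29 439804633907 (.node (.node (.node .leaf 2492681 32 3351587 .leaf) 2492938 32
  1131555 .leaf) 2493193 30 1245184 (.node .leaf 2493194 31 1114112 .leaf))) 2493963 31 2162944
  (.node (.node (.node (.node .leaf 2496276 29 591487284 .leaf) 2497803 30 67318532 .leaf) 2497820
  29 77309485313 (.node .leaf 2498571 31 101081874 .leaf)) 2499337 30 34668548 (.node (.node (.node
  .leaf 2499339 28 70516741 .leaf) 2689289 29 4464643 .leaf) 2689801 31 1327378 (.node .leaf 2689803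
  31 1114115 .leaf))))))) 2694411 31 839069699 (.node (.node (.node (.node (.node (.node (.node
  (.node .leaf 2695179 30 840000564 .leaf) 2886410 31 1130770 .leaf) 2953739 30 18026771 (.node
  (.node .leaf 2953995 25 17899809 .leaf) 2954251 32 272835107 .leaf)) 2955019 31 272777778 (.node
  (.node (.node .leaf 2955790 29 537080675 .leaf) 2956564 30 215018201429 .leaf) 2957335 30
  228474578261 (.node .leaf 2958862 29 349239915826 .leaf))) 2959627 31 356836008277 (.node (.node
  (.node (.node .leaf 3019273 27 1378096641 .leaf) 3019275 25 1378169091 .leaf) 3021588 29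
  370798897187 (.node .leaf 3022868 30 302079305062 .leaf)) 3023904 30 131405652198464 (.node (.node
  (.node .leaf 3084809 30 894505236 .leaf) 3085321 32 90317348 .leaf) 3085322 29 36843571 (.node
  .leaf 3085323 30 55840803 .leaf)))) 3086089 31 87249460 (.node (.node (.node (.node (.node .leaf
  3086091 29 52564514 .leaf) 3087124 30 73587499299 .leaf) 3087127 29 77882098979 (.node (.node
  .leaf 3087634 30 219048587302 .leaf) 3089419 30 73015583058 .leaf)) 3089929 30 356500186402 (.node
  (.node (.node .leaf 3090697 31 219329688918 .leaf) 3090699 29 219177636933 .leaf) 3091731 29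
  88635119480 (.node .leaf 3091986 29 19037979644024 .leaf))) 3541513 27 558104628 (.node (.node
  (.node (.node .leaf 3541770 31 839127344 .leaf) 3541771 32 855909168 .leaf) 3542539 31 587277072
  (.node .leaf 3544852 29 150610200337 .leaf)) 3545618 30 5242885 (.node (.node (.node .leaf 3546123
  31 74106151457 .leaf) 3546379 28 8878362899 .leaf) 3546396 29 19928667586658 (.node .leaf 3547147
  31 8609927443 .leaf))))) 3547150 30 8608171857 (.node (.node (.node (.node (.node (.node .leaf
  3609618 29 293271386112 .leaf) 3672585 31 53568052 .leaf) 3672841 32 55665204 (.node (.node .leaf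
  3672842 31 35873332 .leaf) 3672843 30 3146288 .leaf)) 3673609 31 51470868 (.node (.node (.node
  .leaf 3673611 29 6358272 .leaf) 3674377 30 50405651 .leaf) 3675154 30 73014444032 (.node .leaf
  3675922 29 73014444032 .leaf))) 3676938 31 75180966182 (.node (.node (.node (.node .leaf 3677193
  31 75179917606 .leaf) 3677449 30 4315292690 .leaf) 3677450 29 8609936182 (.node .leaf 3678218 30
  8606795077 .leaf)) 3868937 31 6432290 (.node (.node (.node .leaf 3869449 31 55796036 .leaf)
  3870219 30 6361346 .leaf) 4065545 32 6431522 (.node .leaf 4065801 31 3367493 .leaf)))) 4065802 32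
  6432290 (.node (.node (.node (.node (.node .leaf 4133387 28 146586022705 .leaf) 4133898 29
  215323194418 .leaf) 4133899 30 215320048402 (.node .leaf 4134667 29 215319982610 .leaf)) 4199435
  31 69881832578 (.node (.node (.node .leaf 4200201 28 345817318435 .leaf) 4264458 29 4563501313
  .leaf) 4264459 30 4563480833 (.node .leaf 4264969 30 69273268995 .leaf))) 4264970 31 70900679170
  (.node (.node (.node (.node .leaf 4264971 32 70900662786 .leaf) 4264974 31 70900654594 .leaf)
  4265737 29 69273356291 (.node .leaf 4265739 31 70900654594 .leaf)) 4266507 30 549761582160 (.node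
  (.node (.node .leaf 4267026 29 206191993680 .leaf) 4267028 31 11137170092897 .leaf) 4270347 31
  56079824479236 (.node .leaf 4461323 30 75197744694 .leaf)))))) 4461577 31 103652930355 (.node
  (.node (.node (.node (.node (.node (.node .leaf 4461578 30 69298488117 .leaf) 4722185 29
  77919892530 .leaf) 4786953 31 77936931890 (.node (.node .leaf 4788489 29 10806065170 .leaf)
  4789266 29 19172834709584 .leaf)) 4789268 31 143490932642129 (.node (.node (.node .leaf 4852489 30
  365073424386 .leaf) 4852490 29 377959383042 .leaf) 4856841 29 2890517266692 (.node .leaf 4857099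
  30 35227590459443 .leaf))) 5315083 30 56295217446963 (.node (.node (.node (.node .leaf 5379086 30
  168544180380163 .leaf) 5379849 30 187405104032354 .leaf) 5384459 30 17110311276039237 (.node .leaf
  5444619 30 183618442035715 .leaf)) 5901835 29 56350281580804 (.node (.node (.node .leaf 5971979 30
  9223809622779201 .leaf) 6031881 29 43489899299 .leaf) 6031882 30 13424141347 (.node .leaf 6559499
  30 54201580107975778 .leaf)))) 7408394 30 7882546268488229 (.node (.node (.node (.node (.node
  .leaf 151587081 31 0 .leaf) 168364297 32 0 .leaf) 168429833 33 34 (.node .leaf 185141513 31 0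
  .leaf)) 185207049 32 34 (.node (.node (.node .leaf 185207305 31 0 .leaf) 185272585 33 34 .leaf)
  185272841 32 34 (.node .leaf 185272842 33 34 .leaf))) 185273099 33 0 (.node (.node (.node (.node
  .leaf 235473161 30 0 .leaf) 235538697 31 34 .leaf) 235604233 32 34 (.node .leaf 235604747 32 0
  .leaf)) 285935881 31 8738 (.node (.node (.node .leaf 303172105 30 1114112 .leaf) 303172361 29
  65536 .leaf) 303172363 31 1114112 (.node .leaf 303173131 30 1118481 .leaf))))) 319949065 26
  1127170 (.node (.node (.node (.node (.node (.node .leaf 319949579 30 1114112 .leaf) 319950347 31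
  1315089 .leaf) 320015115 31 1122368 (.node (.node .leaf 336726537 30 1114114 .leaf) 336726793 31
  4259842 .leaf)) 336726794 30 4259841 (.node (.node (.node .leaf 336727561 30 4277250 .leaf)
  336727563 30 4456449 .leaf) 336728329 29 1114130 (.node .leaf 336792329 32 4330515 .leaf)))
  336792330 31 4325379 (.node (.node (.node (.node .leaf 336857609 32 2233363 .leaf) 336857865 33
  1184787 .leaf) 336857866 32 1184787 (.node .leaf 336857867 31 1130544 .leaf)) 336858633 32 136211
  (.node (.node (.node .leaf 387058441 30 4259841 .leaf) 387058442 31 4259842 .leaf) 387123977 31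
  4326163 (.node .leaf 387123979 29 4456452 .leaf)))) 387189257 31 2229267 (.node (.node (.node
  (.node (.node .leaf 387189513 32 3281939 .leaf) 387189515 30 3358768 .leaf) 437390091 31 1122816
  (.node .leaf 437390859 30 1122816 .leaf)) 437521163 29 2228787 (.node (.node (.node .leaf
  437914121 30 8772 .leaf) 453708041 29 12288 .leaf) 453708297 32 12834 (.node .leaf 453708298 33
  13091 .leaf))) 453708553 31 0 (.node (.node (.node (.node .leaf 453708555 33 0 .leaf) 453904649 32
  13091 .leaf) 453905163 32 0 (.node .leaf 453905931 33 69905 .leaf)) 454102539 32 1118738 (.node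
  (.node (.node .leaf 454169102 30 1413759249 .leaf) 454300170 30 1127420177 .leaf) 454300171 29
  1073812548 (.node .leaf 454300682 32 1412702754 .leaf)))))))) 454300683 31 1395793936 (.node
  (.node (.node (.node (.node (.node (.node (.node (.node .leaf 454497289 32 1144136226 .leaf)
  454497291 30 1128416276 .leaf) 454693387 31 1431376145 (.node (.node .leaf 454760212 30
  219903444855 .leaf) 470485257 32 2241315 .leaf)) 470946315 30 18034945 (.node (.node (.node .leaf
  471077385 30 4369 .leaf) 471077643 29 285226017 .leaf) 471077897 32 288563746 (.node .leaf
  471534347 32 1426064643 .leaf))) 487262473 31 8195 (.node (.node (.node (.node .leaf 487262730 31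
  16387 .leaf) 487262985 29 272 .leaf) 487459337 31 279058 (.node .leaf 487655689 29 4464643 .leaf))
  487656201 31 1327122 (.node (.node (.node .leaf 487723531 29 17896961 .leaf) 487854602 28 17850369
  .leaf) 487854603 31 17850372 (.node .leaf 487855113 31 271589890 .leaf)))) 487855114 30 274752002
  (.node (.node (.node (.node (.node .leaf 488051211 30 840982788 .leaf) 488051722 31 1630543874
  .leaf) 488247819 29 572522769 (.node (.node .leaf 488312331 30 1090585875 .leaf) 488314642 30
  585055076419 .leaf)) 488443401 30 308372500 (.node (.node (.node .leaf 488446985 30 143143305238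
  .leaf) 537594121 32 9251 .leaf) 537790729 31 9251 (.node .leaf 537791241 31 82466 .leaf)))
  538186251 30 286724 (.node (.node (.node (.node .leaf 538186505 29 288428290 .leaf) 538186507 31
  291922436 .leaf) 538186763 30 274752005 (.node .leaf 538382859 31 18113540 .leaf)) 538383369 31
  271999570 (.node (.node (.node .leaf 538643211 32 1430275669 .leaf) 538643979 31 1161839957 .leaf)
  538708747 31 291782688 (.node .leaf 538774282 31 906256404 .leaf))))) 587926025 32 9251 (.node
  (.node (.node (.node (.node (.node .leaf 587926283 33 1027 .leaf) 588386827 31 18036229 .leaf)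
  605162249 29 822092322 (.node (.node .leaf 605163019 28 319889682 .leaf) 605293322 30 860110852
  .leaf)) 605293323 31 860106755 (.node (.node (.node .leaf 605294091 30 587276290 .leaf) 605489929
  30 554976052 .leaf) 605489931 30 574894083 (.node .leaf 605492243 31 352557863185 .leaf)))
  605686537 31 1094997317 (.node (.node (.node (.node .leaf 605687307 28 872416352 .leaf) 606082059
  30 430067361106 .leaf) 606082825 31 353871751014 (.node .leaf 606082827 29 362156336770 .leaf))
  606341899 29 146565914630 (.node (.node (.node .leaf 621941001 28 1682202900 .leaf) 622072851 31
  585564041489 .leaf) 622531595 30 435760210691 (.node .leaf 622533129 30 581722768404 .leaf))))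
  638716426 31 287449634 (.node (.node (.node (.node (.node .leaf 638716681 29 822083586 .leaf)
  638716682 30 822083585 .leaf) 638716683 31 855638018 (.node .leaf 638717450 29 291897345 .leaf))
  638717451 30 319881218 (.node (.node (.node .leaf 638781961 31 33628979 .leaf) 638782217 30
  33620035 .leaf) 638782219 30 2 (.node .leaf 638784018 28 73014464516 .leaf))) 638847497 30
  570490899 (.node (.node (.node (.node .leaf 638847498 29 570556419 .leaf) 638847753 31 1108410387
  .leaf) 638847754 30 1108541460 (.node .leaf 639044361 30 588455956 .leaf)) 639240713 30 3359301
  (.node (.node (.node .leaf 639309577 30 146891046963 .leaf) 639373835 30 215303139329 .leaf)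
  639439883 31 69894012933 (.node .leaf 639440650 29 275951801862 .leaf)))))) 639635979 30
  4630721809 (.node (.node (.node (.node (.node (.node (.node .leaf 639636235 29 73353297953 .leaf)
  689048331 30 285212672 .leaf) 689179401 32 571891988 (.node (.node .leaf 689376009 31 1662198036
  .leaf) 689967627 29 4633866513 .leaf)) 689968139 31 69936382466 (.node (.node (.node .leaf
  755698186 31 2294531 .leaf) 755894793 31 71504403 .leaf) 755895819 31 17903969 (.node .leaf
  756091657 31 323035681 .leaf))) 756290315 30 73356350481 (.node (.node (.node (.node .leaf
  756487177 30 70067028994 .leaf) 756813323 31 150862053700 .leaf) 756878090 30 232001922132 (.node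
  .leaf 757074698 31 227656688725 .leaf)) 757666827 30 18143560237686 (.node (.node (.node .leaf
  773067275 30 361924723713 .leaf) 773851913 31 301828891730 .leaf) 789186825 30 290607876 (.node
  .leaf 789187081 31 1664107268 .leaf)))) 789252873 31 894505220 (.node (.node (.node (.node (.node
  .leaf 789252874 30 841040132 .leaf) 789449481 30 1632641282 .leaf) 789844747 30 68856059154 (.node
  .leaf 790041611 30 68721591554 .leaf)) 790301450 30 77865296163 (.node (.node (.node .leaf
  790366985 30 4849803523 .leaf) 790432266 31 221249815894 .leaf) 790432522 30 219051737156 (.node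
  .leaf 790436875 30 181763294889848 .leaf))) 790628873 31 13212206422 (.node (.node (.node (.node
  .leaf 790629130 29 2117637 .leaf) 790825739 29 584249795926 .leaf) 907152907 30 73585983505 (.node
  .leaf 907217675 30 73052332580 .leaf)) 907218443 31 146383516466 (.node (.node (.node .leaf
  907283211 29 146062704768 .leaf) 907283979 30 146114023729 .leaf) 907479817 30 150391317568 (.node
  .leaf 907479818 31 158998086992 .leaf))))) 907676169 30 1145446996 (.node (.node (.node (.node
  (.node (.node .leaf 908072715 31 17875687467264 .leaf) 908659467 30 75063143655728 .leaf)
  923994891 31 366487155253 (.node (.node .leaf 940706570 30 4297228582 .leaf) 940707337 30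
  4296180246 .leaf)) 940772105 30 73016705574 (.node (.node (.node .leaf 940772106 31 146032132918
  .leaf) 940838411 30 146030006529 .leaf) 941033737 30 73149071429 (.node .leaf 941230857 31
  4585957394 .leaf))) 941299467 30 184717953466420 (.node (.node (.node (.node .leaf 941886987 30
  137474122264 .leaf) 942017290 30 4510006486613 .leaf) 942213897 30 187028932699704 (.node .leaf
  991103753 31 77866304358 .leaf)) 991170057 31 146315231559 (.node (.node (.node .leaf 1057688330
  30 146570163248 .leaf) 1058477067 30 17936320562176 .leaf) 1059064586 29 57175147108000 (.node
  .leaf 1091176713 28 537080627 .leaf)))) 1091242505 30 539177780 (.node (.node (.node (.node (.node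
  .leaf 1091242506 31 539112229 .leaf) 1091242763 31 12336 .leaf) 1091440139 31 4581298433 (.node
  .leaf 1091834635 30 11295527172 .leaf)) 1092030987 30 2685665556 (.node (.node (.node .leaf
  1092357643 31 3440605479937 .leaf) 1092619018 31 11002113731092 .leaf) 1142166283 31
  52779412627588 (.node .leaf 1191840265 31 146703659907 .leaf))) 1209469707 30 56302730774784
  (.node (.node (.node (.node .leaf 1226443529 30 177097173733908 .leaf) 1242827530 30 2310864647235
  .leaf) 1393232650 30 124318115304213 (.node .leaf 77494618377 29 0 .leaf)) 77494683913 30 13056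
  (.node (.node (.node .leaf 77494684169 31 8704 .leaf) 77494684170 32 13056 .leaf) 77494684427 32
  68 (.node .leaf 77545015561 31 13056 .leaf))))))) 77545016075 31 68 (.node (.node (.node (.node
  (.node (.node (.node (.node .leaf 81755965705 27 3355392 .leaf) 81789651209 31 13056 .leaf)
  81789651465 32 82945 (.node (.node .leaf 81789651721 31 69905 .leaf) 81789651722 30 17 .leaf))
  81839982857 32 17443 (.node (.node (.node .leaf 81907550985 27 370217232 .leaf) 81907550987 29
  287449696 .leaf) 81907551755 30 371344481 (.node .leaf 81924328203 30 287449634 .leaf)))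
  86084552969 31 1027 (.node (.node (.node (.node .leaf 86084553225 32 70659 .leaf) 86084618761 31
  1118497 .leaf) 86084619017 32 4264193 (.node .leaf 86084619018 31 4264193 .leaf)) 86084619019 30
  4473860 (.node (.node (.node .leaf 86134819081 31 4473859 .leaf) 86185216265 29 1115171 .leaf)
  86185281801 32 17443 (.node .leaf 86202518282 29 1627389953 .leaf)))) 86202519049 29 285212674
  (.node (.node (.node (.node (.node .leaf 86219295497 29 822083586 .leaf) 86219295498 30 822083586
  .leaf) 86219361033 30 1644167170 (.node (.node .leaf 86236072714 31 16782869 .leaf) 86236072715 28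
  8224 .leaf)) 86236073481 31 16782869 (.node (.node (.node .leaf 86236138249 31 553653781 .leaf)
  86236138250 32 570430997 .leaf) 86236138251 31 570437680 (.node .leaf 86236203529 31 570688259
  .leaf))) 98969389321 31 1027 (.node (.node (.node (.node .leaf 98969454857 32 13347 .leaf)
  98969520905 31 4264193 .leaf) 98969520906 32 4264193 (.node .leaf 99070183689 31 2237475 .leaf))
  99087420170 30 1627389954 (.node (.node (.node .leaf 99087420171 29 1711276038 .leaf) 99104197385
  30 285214242 .leaf) 99120974601 31 285218325 (.node .leaf 99121040137 32 34936341 .leaf)))))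
  99121105675 31 0 (.node (.node (.node (.node (.node (.node .leaf 111837579529 32 1122884 .leaf)
  111854422281 32 8738 .leaf) 111854422537 31 8738 (.node (.node .leaf 111854422793 30 0 .leaf)
  111904622857 29 2236416 .leaf)) 111904753929 31 8738 (.node (.node (.node .leaf 112006007563 30
  570688256 .leaf) 116267027211 31 572661760 .leaf) 116267223561 29 337920562 (.node .leaf
  116283607305 27 857735714 .leaf))) 116283607819 31 572719104 (.node (.node (.node (.node .leaf
  116283804427 32 573775872 .leaf) 116300385034 31 876613905 .leaf) 116300581641 31 607129873 (.node
  .leaf 116300581643 31 573579328 .leaf)) 116300779017 29 826286369 (.node (.node (.node .leaf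
  116350716682 32 894439697 .leaf) 116401048329 30 1162870784 .leaf) 120561797899 31 278528 (.node
  .leaf 120595352329 31 18092305 .leaf)))) 124856961545 30 106955026 (.node (.node (.node (.node
  (.node .leaf 124857158409 30 39846178 .leaf) 124873542411 31 418820 .leaf) 124890253577 29 2248708
  (.node .leaf 124890253833 30 16645 .leaf)) 124890319369 31 6578212 (.node (.node (.node .leaf
  124890319370 32 3301412 .leaf) 124890319627 32 417796 .leaf) 124890515721 31 1714577508 (.node
  .leaf 124890516233 31 375529794 .leaf))) 124940585225 30 2244613 (.node (.node (.node (.node .leaf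
  124940650761 31 575823908 .leaf) 124940651274 30 1628835841 .leaf) 124990982409 30 572662533
  (.node .leaf 125008350731 31 154754093315 .leaf)) 125008743179 30 855639040 (.node (.node (.node
  .leaf 125025127179 31 1479541763 .leaf) 125042100745 30 353613459475 .leaf) 137741667083 31
  1145325141 (.node .leaf 137758444299 30 1717978112 .leaf)))))) 137775221001 31 3301412 (.node
  (.node (.node (.node (.node (.node (.node .leaf 137775221257 32 107241764 .leaf) 137775221514 30
  409601 .leaf) 137775418121 32 325132578 (.node (.node .leaf 137775747595 30 25264390 .leaf)
  137775813131 29 4571825153 .leaf)) 137825552649 32 3302180 (.node (.node (.node .leaf 137826013707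
  30 4616980486 .leaf) 137893251850 30 154669154308 .leaf) 137893448459 32 146163106563 (.node .leaf
  137909897995 30 73587370055 .leaf))) 137926740745 30 365156532790 (.node (.node (.node (.node
  .leaf 150626568713 31 2098725 .leaf) 150660123403 30 858796032 .leaf) 150760786697 30 1557 (.node
  .leaf 154804095754 31 1145307408 .leaf)) 154854427401 31 35914000 (.node (.node (.node .leaf
  154904955657 29 554828592 .leaf) 154955550219 29 73584939009 .leaf) 154955681291 31 146096197633
  (.node .leaf 155005946635 30 146571218949 .leaf)))) 155006012171 31 146096193536 (.node (.node
  (.node (.node (.node .leaf 155106085642 29 293134881589 .leaf) 155156417290 30 297695118128 .leaf)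
  163393964297 29 139264 (.node .leaf 163394030089 31 288571938 .leaf)) 163394030347 32 859004928
  (.node (.node (.node .leaf 163444361481 31 2241058 .leaf) 163511930379 29 73300774944 .leaf)
  163528706827 29 73014452226 (.node .leaf 163528772363 30 146569965570 .leaf))) 163545484042 29
  279173006865 (.node (.node (.node (.node .leaf 163545614858 30 146163630080 .leaf) 163545615114 31
  421243588881 .leaf) 163595815690 30 292057841682 (.node .leaf 163696019977 29 537088054 .leaf))
  176278932233 31 17916180 (.node (.node (.node .leaf 176379595017 31 572928819 .leaf) 176396831499
  29 73587097600 .leaf) 176430385929 29 279173333009 (.node .leaf 176430517001 31 558749978897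
  .leaf))))) 176480717577 30 554053222934 (.node (.node (.node (.node (.node (.node .leaf
  176547367691 31 586269339648 .leaf) 176580922123 31 84432134 .leaf) 176631845387 30 1170020672516
  (.node (.node .leaf 176632302347 30 18708983795754 .leaf) 176699149067 30 187168769877000 .leaf))
  193593412361 29 83265528355 (.node (.node (.node .leaf 193660128011 31 73426000 .leaf)
  193811909387 30 345010892960 .leaf) 197871602441 29 74696450578 (.node .leaf 202182953737 29
  558882644227 .leaf))) 202182953738 30 563446038788 (.node (.node (.node (.node .leaf 202199730697
  29 270532613 .leaf) 202199730954 31 13715443988 .leaf) 202250062601 31 4588638548 (.node .leaf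
  202351512330 30 99029071501176 .leaf)) 202401581835 30 186938462044278 (.node (.node (.node .leaf
  12142057818633 32 8738 .leaf) 15440592701705 32 8738 .leaf) 18739110676745 30 2236484 (.node .leaf
  19868754316043 30 17510 .leaf)))) 20972510579467 31 0 (.node (.node (.node (.node (.node .leaf
  22067727239946 30 823197697 .leaf) 22072022207242 31 1091633169 .leaf) 22076317174538 32 17896981
  (.node .leaf 25366262123274 31 1628504065 .leaf)) 25366362786057 30 573964339 (.node (.node (.node
  .leaf 25370557090569 31 17892881 .leaf) 25374852057609 31 17891858 .leaf) 25374852057865 32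
  17896981 (.node .leaf 28664797006345 30 3342370 .leaf))) 28669091973385 30 1144193058 (.node
  (.node (.node (.node .leaf 28673386875145 30 1145374003 .leaf) 28686271711497 30 1145308467 .leaf)
  31933267118601 30 1631862786 (.node .leaf 31984957721354 31 554344386564 .leaf)) 35270574148362 29
  17850625 (.node (.node (.node .leaf 35270590925579 31 8421382 .leaf) 39694323354377 30 9144711011
  .leaf) 45191831161097 30 365934551591 (.node .leaf 7333789987178761 31 1143087650 .leaf))))))))

theorem check_lowerTable : lowerTable.check 12111210 lowerTable = true := by decide +kernel

theorem check_upperTable : upperTable.check 210111012 upperTable = true := by decide +kernel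

/-! ### Uncoloured paths -/

section Path

variable {V : Type*} [DecidableEq V]

theorem attains_neg_one {m : ℕ} (hm : Even m) (h0 : 0 < m) :
    Attains V (-1) {9 * m + 4} (2 * (m / 16 : ℕ) + 1) := by
  have he : StrategyTable.IsPayoffCode (-1) 12111210 := by
    unfold StrategyTable.IsPayoffCode; decide
  have hp : ∀ {n t : ℕ}, lowerTable.find n = t + 1 → decodeSegs 16 n = [n] →
      Attains V (-1) {n} ((t : ℤ) - 33) :=
    StrategyTable.attains_of_find he check_lowerTable
  have h2 : Attains V (-1) {9 * 2 + 4} 1 :=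
    hp (t := 34) (by decide +kernel) (by decide +kernel)
  have h16 : Attains V (-1) {9 * 16 + 4} 3 :=
    hp (t := 36) (by decide +kernel) (by decide +kernel)
  induction m using Nat.strong_induction_on with
  | _ m ih =>
    have h := Nat.even_iff.1 hm
    rcases lt_trichotomy m 16 with h' | rfl | h'
    · obtain rfl | h'' := eq_or_ne m 2
      · exact h2
      · have := Attains.join (by simp) h2
          (ih (m - 2) (by omega) (Nat.even_iff.2 (by omega)) (by omega))
        rw [Nat.add_sub_cancel' (by omega)] at this
        exact this.mono (by omega)
    · exact h16
    · have := Attains.join (by simp) h16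
        (ih (m - 16) (by omega) (Nat.even_iff.2 (by omega)) (by omega))
      rw [Nat.add_sub_cancel' (by omega)] at this
      exact this.mono (by omega)

theorem attains_one {m : ℕ} (hm : Even m) (h0 : 0 < m) :
    Attains V 1 {9 * m + 4} (-(4 * ((m - 1) / 16 : ℕ) + 3)) := by
  have he : StrategyTable.IsPayoffCode 1 210111012 := by
    unfold StrategyTable.IsPayoffCode; decide
  have hp : ∀ m ∈ [2, 4, 6, 8, 10, 12, 14, 16], Attains V 1 {9 * m + 4} (-3) := by
    intro m hm
    refine StrategyTable.attains_of_find he check_upperTable (m := 30) ?_ ?_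
    · revert m; decide +kernel
    · revert m; decide +kernel
  induction m using Nat.strong_induction_on with
  | _ m ih =>
    have h := Nat.even_iff.1 hm
    rcases le_or_gt m 16 with h' | h'
    · exact (hp m (by simp; omega)).mono (by omega)
    · have := Attains.join (by simp) (hp 16 (by simp))
        (ih (m - 16) (by omega) (Nat.even_iff.2 (by omega)) (by omega))
      rw [Nat.add_sub_cancel' (by omega)] at this
      exact this.mono (by omega)

end Path

/-! ### The score on a path -/

section PathGraph

theorem payoff_neg {V : Type*} (s : ℤ) (c : V → Bool) (l r : ℤ) (us : List V) :
    payoff (-s) c l us r = -payoff s c l us r := by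
  induction us generalizing l with
  | nil => simp only [payoff]; ring
  | cons u us ih => simp only [payoff, ih]; ring

theorem payoff_ofFn {V : Type*} (s : ℤ) (c : V → Bool) (l : ℤ) {m : ℕ} (f : Fin (m + 1) → V) :
    payoff s c l (List.ofFn f) 0 = s * l * colorSign (c (f 0)) +
      ∑ i : Fin m, s * colorSign (c (f i.castSucc)) * colorSign (c (f i.succ)) := by
  induction m generalizing l with
  | zero => simp [payoff]
  | succ m ih =>
    rw [List.ofFn_succ, payoff, ih, Fin.sum_univ_succ]
    simp

theorem pathGraph_sep_edgeSet_ncard {m : ℕ} (P : Sym2 (Fin (m + 1)) → Prop) [DecidablePred P] :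
    {e ∈ (pathGraph (m + 1)).edgeSet | P e}.ncard =
      (Finset.univ.filter fun i : Fin m => P s(i.castSucc, i.succ)).card := by
  have hinj : Function.Injective fun i : Fin m => s(i.castSucc, i.succ) := by
    intro i j h
    simp only [Sym2.eq_iff, Fin.ext_iff, Fin.val_castSucc, Fin.val_succ] at h
    exact Fin.ext (by omega)
  rw [← Finset.card_image_of_injective _ hinj, ← Set.ncard_coe_finset]
  congr 1
  ext e
  simp only [Set.mem_ofPred_eq, Finset.coe_image, Finset.coe_filter, Finset.mem_univ, true_and,
    Set.mem_image]
  constructor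
  · induction e using Sym2.ind with
    | _ x y =>
      rintro ⟨h, hP⟩
      rw [mem_edgeSet, pathGraph_adj] at h
      rcases h with h | h
      · have he : s((⟨x, by omega⟩ : Fin m).castSucc, (⟨x, by omega⟩ : Fin m).succ) = s(x, y) := by
          rw [show (⟨x, by omega⟩ : Fin m).succ = y from Fin.ext h]
          rfl
        exact ⟨_, he.symm ▸ hP, he⟩
      · have he : s((⟨y, by omega⟩ : Fin m).castSucc, (⟨y, by omega⟩ : Fin m).succ) = s(x, y) := by
          rw [show (⟨y, by omega⟩ : Fin m).succ = x from Fin.ext h, Sym2.eq_swap]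
          rfl
        exact ⟨_, he.symm ▸ hP, he⟩
  · rintro ⟨i, hP, rfl⟩
    exact ⟨by simp [pathGraph_adj], hP⟩

theorem bscore_pathGraph {m : ℕ} (c : Fin (m + 1) → Bool) (b : Bool) :
    bscore (pathGraph (m + 1)) {v | c v = b} {v | c v = !b} =
      payoff (-1) c 0 (List.ofFn id) 0 := by
  classical
  rw [bscore, pathGraph_sep_edgeSet_ncard, pathGraph_sep_edgeSet_ncard, payoff_ofFn,
    Finset.card_filter, Finset.card_filter]
  push_cast
  rw [← Finset.sum_sub_distrib, zero_mul, zero_add]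
  refine Finset.sum_congr rfl fun i _ => ?_
  have h₁ : (∃ u ∈ {v | c v = b}, ∃ v ∈ {v | c v = !b}, s(i.castSucc, i.succ) = s(u, v)) ↔
      c i.castSucc ≠ c i.succ := by
    simp only [Set.mem_ofPred_eq, Sym2.eq_iff]
    constructor
    · rintro ⟨u, hu, v, hv, ⟨h, h'⟩ | ⟨h, h'⟩⟩ <;> rw [h, h', hu, hv] <;> simp
    · intro h
      by_cases hb : c i.castSucc = b
      · exact ⟨_, hb, _, by rw [← hb]; exact Bool.eq_not_of_ne h.symm, .inl ⟨rfl, rfl⟩⟩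
      · have hb := Bool.eq_not_of_ne hb
        refine ⟨i.succ, ?_, _, hb, .inr ⟨rfl, rfl⟩⟩
        rw [Bool.eq_not_of_ne h.symm, hb, Bool.not_not]
  have h₂ : ((∃ u ∈ {v | c v = b}, ∃ v ∈ {v | c v = b}, s(i.castSucc, i.succ) = s(u, v)) ∨
      (∃ u ∈ {v | c v = !b}, ∃ v ∈ {v | c v = !b}, s(i.castSucc, i.succ) = s(u, v))) ↔
      c i.castSucc = c i.succ := by
    simp only [Set.mem_ofPred_eq, Sym2.eq_iff]
    constructor
    · rintro (⟨u, hu, v, hv, ⟨h, h'⟩ | ⟨h, h'⟩⟩ | ⟨u, hu, v, hv, ⟨h, h'⟩ | ⟨h, h'⟩⟩) <;>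
        rw [h, h', hu, hv]
    · intro h
      by_cases hb : c i.castSucc = b
      · exact .inl ⟨_, hb, _, h ▸ hb, .inl ⟨rfl, rfl⟩⟩
      · have hb := Bool.eq_not_of_ne hb
        exact .inr ⟨_, hb, _, h ▸ hb, .inl ⟨rfl, rfl⟩⟩
  simp only [h₁, h₂, id]
  cases c i.castSucc <;> cases c i.succ <;> simp [colorSign]

theorem payoff_ofFn_succ_le {m : ℕ} {s : ℤ} (hs : |s| = 1) (c : Fin (m + 1) → Bool) :
    payoff s c 0 (List.ofFn (Fin.succ : Fin m → Fin (m + 1))) 0 - 1 ≤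
      payoff s c 0 (List.ofFn id) 0 := by
  have := payoff_zero_left_le c hs (abs_colorSign (c 0)).le
    (List.ofFn (Fin.succ : Fin m → Fin (m + 1)))
  rw [List.ofFn_succ, payoff, mul_zero, zero_mul, zero_add]
  exact this

theorem Attains.ensures {V : Type*} [DecidableEq V] {s t : ℤ} {us : List V}
    (h : Attains V s {9 * us.length + 4} t) (hus : us.Nodup) {F : Finset V}
    (hF : ∀ x, x ∈ F ↔ x ∈ us) (c : V → Bool) :
    Ensures (fun c => t ≤ payoff s c 0 us 0) F c := by
  have hF : F.val = us := (Multiset.Nodup.ext F.nodup (Multiset.coe_nodup.2 hus)).2 hF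
  have := h {(9 * us.length + 4, us)} F c (by simp)
    (by simp only [Multiset.mem_singleton, forall_eq]; omega) (by simp [hF, segVertices])
  refine this.mono fun c' _ h' => ?_
  have h₁ : leftSign (9 * us.length + 4) = 0 := by simp only [leftSign]; omega
  have h₂ : rightSign (9 * us.length + 4) = 0 := by simp only [rightSign]; omega
  simpa [segPayoff, h₁, h₂] using h'

theorem Attains.ensures_univ {m : ℕ} {s t : ℤ} (h : Attains (Fin m) s {9 * m + 4} t)
    (c : Fin m → Bool) : Ensures (fun c => t ≤ payoff s c 0 (List.ofFn id) 0) Finset.univ c :=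
  Attains.ensures (by rwa [List.length_ofFn]) (List.nodup_ofFn.2 Function.injective_id) (by simp) c

theorem Attains.ensures_erase_zero {m : ℕ} {s t : ℤ} (hs : |s| = 1)
    (h : Attains (Fin (m + 1)) s {9 * m + 4} t) (c : Fin (m + 1) → Bool) :
    Ensures (fun c => t - 1 ≤ payoff s c 0 (List.ofFn id) 0) (Finset.univ.erase 0) c := by
  have hnd : (List.ofFn (Fin.succ : Fin m → Fin (m + 1))).Nodup :=
    List.nodup_ofFn.2 (Fin.succ_injective m)
  refine (Attains.ensures (by rwa [List.length_ofFn]) hnd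
    (by simp [List.mem_ofFn, Fin.exists_succ_eq]) c).mono fun c' _ h' => ?_
  linarith [payoff_ofFn_succ_le hs c']

theorem CanForce.le_balA_pathGraph {m : ℕ} {T : ℤ} {c : Fin (m + 1) → Bool}
    (h : CanForce (fun c => T ≤ payoff (-1) c 0 (List.ofFn id) 0) (m + 1) false Finset.univ c) :
    T ≤ balA (pathGraph (m + 1)) := by
  refine CanForce.le_balA _ (c := c) ?_
  simpa only [Fintype.card_fin, ← bscore_pathGraph _ false, Bool.not_false] using h

theorem CanForce.balA_pathGraph_le {m : ℕ} {T : ℤ} {c : Fin (m + 1) → Bool}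
    (h : CanForce (fun c => -T ≤ payoff 1 c 0 (List.ofFn id) 0) (m + 1) true Finset.univ c) :
    balA (pathGraph (m + 1)) ≤ T := by
  refine CanForce.balA_le _ (c := c) ?_
  have (c : Fin (m + 1) → Bool) : bscore (pathGraph (m + 1)) {v | c v = true} {v | c v = false} =
      -payoff 1 c 0 (List.ofFn id) 0 := by rw [← payoff_neg, ← bscore_pathGraph c true]; rfl
  simpa only [Fintype.card_fin, this, neg_le] using h

theorem le_balA_pathGraph_of_even {m : ℕ} (hm : Even (m + 1)) :
    2 * ((m + 1) / 16 : ℕ) + 1 ≤ balA (pathGraph (m + 1)) := by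
  have := ((attains_neg_one hm m.succ_pos).ensures_univ fun _ => false).canForce_false
  rw [Finset.card_univ, Fintype.card_fin] at this
  exact this.le_balA_pathGraph

theorem balA_pathGraph_le_of_even {m : ℕ} (hm : Even (m + 1)) :
    balA (pathGraph (m + 1)) ≤ 4 * (m / 16 : ℕ) + 3 := by
  have := ((attains_one hm m.succ_pos).ensures_univ fun _ => false).canForce_true
  rw [Finset.card_univ, Fintype.card_fin] at this
  exact this.balA_pathGraph_le

theorem card_univ_erase_zero (m : ℕ) : (Finset.univ.erase (0 : Fin (m + 1))).card = m := by
  simp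

theorem le_balA_pathGraph_of_odd {m : ℕ} {t : ℤ} (h : Attains (Fin (m + 1)) (-1) {9 * m + 4} t) :
    t - 1 ≤ balA (pathGraph (m + 1)) := by
  have := (h.ensures_erase_zero (by simp) fun _ => false).canForce_insert
    (Finset.notMem_erase _ _) rfl
  rw [card_univ_erase_zero, Finset.insert_erase (Finset.mem_univ _)] at this
  exact this.le_balA_pathGraph

theorem balA_pathGraph_le_of_odd {m : ℕ} {t : ℤ} (h : Attains (Fin (m + 1)) 1 {9 * m + 4} (-t)) :
    balA (pathGraph (m + 1)) ≤ t + 1 := by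
  refine CanForce.balA_pathGraph_le (c := fun _ => false) ⟨0, Finset.mem_univ _, ?_⟩
  have := (h.ensures_erase_zero (by simp)
    (Function.update (fun _ => false) 0 true)).canForce_false
  rw [card_univ_erase_zero] at this
  rwa [neg_add']

theorem Attains.free_zero {V : Type*} [DecidableEq V] (s : ℤ) : Attains V s {9 * 0 + 4} 0 := by
  simpa [leftSign] using (Attains.zero (V := V) (s := s)).cons_of_lt (n := 4) (by omega)

end PathGraph

theorem statement_15 (n : ℕ) (hn : 1 ≤ n) :
    (Even n →
      2 * ((n / 16 : ℕ) : ℤ) + 1 ≤ balA (SimpleGraph.pathGraph n) ∧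
      balA (SimpleGraph.pathGraph n) ≤ 4 * (((n + 15) / 16 : ℕ) : ℤ) + 5) ∧
    (Odd n →
      2 * ((n / 16 : ℕ) : ℤ) - 4 ≤ balA (SimpleGraph.pathGraph n) ∧
      balA (SimpleGraph.pathGraph n) ≤ 4 * (((n + 15) / 16 : ℕ) : ℤ)) := by
  obtain ⟨m, rfl⟩ := Nat.exists_eq_add_of_le' hn
  refine ⟨fun h => ⟨le_balA_pathGraph_of_even h, ?_⟩, fun h => ?_⟩
  · have := balA_pathGraph_le_of_even h
    omega
  · have hm : Even m := by simpa [Nat.odd_add_one] using h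
    obtain rfl | h0 := m.eq_zero_or_pos
    · have h₁ := le_balA_pathGraph_of_odd (Attains.free_zero (V := Fin 1) (-1))
      have h₂ := balA_pathGraph_le_of_odd (t := 0) (by simpa using Attains.free_zero (V := Fin 1) 1)
      omega
    · have h₁ := le_balA_pathGraph_of_odd (attains_neg_one hm h0)
      have h₂ := balA_pathGraph_le_of_odd (attains_one hm h0)
      have := Nat.even_iff.1 hm
      omega
end
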